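/- arXiv:1509.02469 — 6 statements merged into one kernel-verified Lean document; each statement's English description precedes it below -/
import Mathlib

section
/- For every natural number r and every real number x, x^r = \sum_{l} ((2l+1)\, r!)/(2^{(r-l)/2} ((r-l)/2)! \,(l+r+1)!!) \, P_l(x), where the sum runs over all integers l with 0 \le l \le r and l \equiv r (mod 2). -/
noncomputable section

/-- The Legendre polynomial of degree `l`, given by Rodrigues' formula
`P_l(x) = (1/(2^l l!)) (d^l/dx^l)(x^2-1)^l`. -/
def legendreP (l : ℕ) (x : ℝ) : ℝ :=
  (1 / (2 ^ l * (l.factorial : ℝ))) * iteratedDeriv l (fun y : ℝ => (y ^ 2 - 1) ^ l) x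

open Polynomial in
theorem iterate_derivative_sq_sub_one_pow_succ (n k : ℕ) :
    derivative^[k + 1] ((X ^ 2 - 1 : ℝ[X]) ^ (n + 1)) =
      2 * ((n : ℝ[X]) + 1) * (X * derivative^[k] ((X ^ 2 - 1 : ℝ[X]) ^ n) +
        (k : ℝ[X]) * derivative^[k - 1] ((X ^ 2 - 1 : ℝ[X]) ^ n)) := by
  have h : derivative ((X ^ 2 - 1 : ℝ[X]) ^ (n + 1)) =
      ((2 * (n + 1) : ℕ) : ℝ[X]) * ((X ^ 2 - 1 : ℝ[X]) ^ n * X) := by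
    rw [derivative_pow_succ]
    simp
    ring
  rw [Function.iterate_succ_apply, h, iterate_derivative_natCast_mul, iterate_derivative_mul_X]
  simp only [nsmul_eq_mul]
  push_cast
  ring

open Polynomial in
theorem iterate_derivative_sq_sub_one_mul (p : ℝ[X]) (k : ℕ) :
    derivative^[k + 1] ((X ^ 2 - 1) * p) =
      (X ^ 2 - 1) * derivative^[k + 1] p + 2 * ((k : ℝ[X]) + 1) * X * derivative^[k] p +
        ((k : ℝ[X]) + 1) * (k : ℝ[X]) * derivative^[k - 1] p := by
  have h : (X ^ 2 - 1) * p = p * X * X - p := by ring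
  rw [h, iterate_derivative_sub, iterate_derivative_mul_X, iterate_derivative_mul_X,
    Nat.add_sub_cancel, iterate_derivative_mul_X]
  simp only [nsmul_eq_mul]
  push_cast
  ring

open Polynomial in
/-- The unnormalised form of Bonnet's recursion. -/
theorem iterate_derivative_sq_sub_one_pow_recurrence (m : ℕ) :
    derivative^[m + 2] ((X ^ 2 - 1 : ℝ[X]) ^ (m + 2)) =
      2 * (2 * (m : ℝ[X]) + 3) * X * derivative^[m + 1] ((X ^ 2 - 1 : ℝ[X]) ^ (m + 1)) -
        4 * ((m : ℝ[X]) + 1) ^ 2 * derivative^[m] ((X ^ 2 - 1 : ℝ[X]) ^ m) := by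
  have hA := iterate_derivative_sq_sub_one_pow_succ (m + 1) (m + 1)
  have hB : ((m : ℝ[X]) + 2) * derivative^[m] ((X ^ 2 - 1 : ℝ[X]) ^ (m + 1)) =
      X * derivative^[m + 1] ((X ^ 2 - 1 : ℝ[X]) ^ (m + 1)) -
        2 * ((m : ℝ[X]) + 1) * derivative^[m] ((X ^ 2 - 1 : ℝ[X]) ^ m) := by
    have h1 := iterate_derivative_sq_sub_one_pow_succ m m
    rcases m with _ | m
    · simp at h1 ⊢
      rw [h1]
      ring
    · have h2 := iterate_derivative_sq_sub_one_pow_succ (m + 1) m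
      have h3 := iterate_derivative_sq_sub_one_mul ((X ^ 2 - 1 : ℝ[X]) ^ (m + 1)) m
      rw [← pow_succ'] at h3
      simp only [Nat.add_sub_cancel] at h1
      push_cast at h1 h2 h3 ⊢
      rw [h1]
      linear_combination (2 * (m : ℝ[X]) + 4) * h3 - ((m : ℝ[X]) + 1) * h2
  simp only [Nat.add_sub_cancel] at hA
  push_cast at hA
  rw [hA]
  linear_combination 2 * ((m : ℝ[X]) + 1) * hB

theorem iteratedDeriv_polynomial_eval (p : Polynomial ℝ) (n : ℕ) :
    iteratedDeriv n (fun y => p.eval y) = fun y => (Polynomial.derivative^[n] p).eval y := by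
  induction n with
  | zero => simp
  | succ n ih =>
    ext y
    rw [iteratedDeriv_succ, ih, Polynomial.deriv, Function.iterate_succ_apply']

open Polynomial in
theorem legendreP_eq_eval (l : ℕ) (x : ℝ) :
    legendreP l x =
      (derivative^[l] ((X ^ 2 - 1 : ℝ[X]) ^ l)).eval x / (2 ^ l * (l.factorial : ℝ)) := by
  have h : (fun y : ℝ => (y ^ 2 - 1) ^ l) = fun y => ((X ^ 2 - 1 : ℝ[X]) ^ l).eval y := by
    ext y
    simp
  rw [legendreP, h, iteratedDeriv_polynomial_eval]
  ring

theorem legendreP_zero (x : ℝ) : legendreP 0 x = 1 := by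
  simp [legendreP_eq_eval]

theorem legendreP_one (x : ℝ) : legendreP 1 x = x := by
  simp [legendreP_eq_eval]
  ring

/-- Bonnet's recursion; for `l = 0` the last term vanishes. -/
theorem legendreP_recurrence (l : ℕ) (x : ℝ) :
    (2 * l + 1) * (x * legendreP l x) =
      (l + 1) * legendreP (l + 1) x + l * legendreP (l - 1) x := by
  rcases l with _ | m
  · simp [legendreP_zero, legendreP_one]
  · have h := congrArg (Polynomial.eval x) (iterate_derivative_sq_sub_one_pow_recurrence m)
    simp only [Polynomial.eval_sub, Polynomial.eval_mul, Polynomial.eval_add, Polynomial.eval_pow,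
      Polynomial.eval_natCast, Polynomial.eval_ofNat, Polynomial.eval_X, Polynomial.eval_one] at h
    simp only [legendreP_eq_eval, Nat.add_sub_cancel, add_assoc, Nat.reduceAdd]
    rw [h, show m + 2 = (m + 1) + 1 from rfl, Nat.factorial_succ (m + 1), Nat.factorial_succ m]
    have hm : (m.factorial : ℝ) ≠ 0 := by positivity
    have hm1 : (m : ℝ) + 1 ≠ 0 := by positivity
    have hm2 : (m : ℝ) + 2 ≠ 0 := by positivity
    have hm3 : (m : ℝ) + 1 + 1 ≠ 0 := by positivity
    push_cast
    field_simp
    ring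

/-- The coefficient of `P_l` in the Legendre expansion of `x ^ r`, divided by `2 * l + 1`. -/
def legendreCoeff (r l : ℕ) : ℝ :=
  if l ≤ r ∧ l % 2 = r % 2 then
    (r.factorial : ℝ) /
      (2 ^ ((r - l) / 2) * ((r - l) / 2).factorial * Nat.doubleFactorial (l + r + 1))
  else 0

theorem legendreCoeff_add_two_mul (l k : ℕ) :
    legendreCoeff (l + 2 * k) l =
      ((l + 2 * k).factorial : ℝ) /
        (2 ^ k * k.factorial * Nat.doubleFactorial (2 * l + 2 * k + 1)) := by
  have h1 : (l + 2 * k - l) / 2 = k := by omega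
  rw [legendreCoeff, if_pos (by omega), h1, show l + (l + 2 * k) + 1 = 2 * l + 2 * k + 1 by ring]

theorem legendreCoeff_of_not {r l : ℕ} (h : ¬(l ≤ r ∧ l % 2 = r % 2)) :
    legendreCoeff r l = 0 :=
  if_neg h

theorem legendreCoeff_succ (r l : ℕ) :
    (2 * l + 1) * legendreCoeff (r + 1) l =
      l * legendreCoeff r (l - 1) + (l + 1) * legendreCoeff r (l + 1) := by
  by_cases h : l ≤ r + 1 ∧ l % 2 = (r + 1) % 2
  · obtain ⟨k, hk⟩ : ∃ k, r + 1 = l + 2 * k := ⟨(r + 1 - l) / 2, by omega⟩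
    have hL : (l : ℝ) * legendreCoeff r (l - 1) = l * ((r.factorial : ℝ) /
        (2 ^ k * k.factorial * Nat.doubleFactorial (2 * l + 2 * k - 1))) := by
      rcases l with _ | l
      · simp
      · obtain rfl : r = l + 2 * k := by omega
        rw [Nat.add_sub_cancel, legendreCoeff_add_two_mul]
        congr 5
        omega
    have hR : legendreCoeff r (l + 1) = (r.factorial : ℝ) * (2 * k) /
        (2 ^ k * k.factorial * Nat.doubleFactorial (2 * l + 2 * k + 1)) := by
      rcases k with _ | k
      · rw [legendreCoeff_of_not (by omega)]
        simp
      · obtain rfl : r = l + 1 + 2 * k := by omega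
        rw [legendreCoeff_add_two_mul, Nat.factorial_succ k,
          show 2 * (l + 1) + 2 * k + 1 = 2 * l + 2 * (k + 1) + 1 by ring]
        push_cast
        field_simp
        ring
    have hd : Nat.doubleFactorial (2 * l + 2 * k + 1) =
        (2 * l + 2 * k + 1) * Nat.doubleFactorial (2 * l + 2 * k - 1) := by
      obtain ⟨n, hn⟩ : ∃ n, 2 * l + 2 * k = n + 1 := ⟨2 * l + 2 * k - 1, by omega⟩
      rw [hn, Nat.doubleFactorial_add_two, Nat.add_sub_cancel]
    have hr : (r : ℝ) + 1 = l + 2 * k := by exact_mod_cast hk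
    have hd0 : (Nat.doubleFactorial (2 * l + 2 * k - 1) : ℝ) ≠ 0 := by
      exact_mod_cast (Nat.doubleFactorial_pos _).ne'
    have hd1 : 2 * (l : ℝ) + 2 * k + 1 ≠ 0 := by positivity
    rw [hL, hR, hk, legendreCoeff_add_two_mul, ← hk, Nat.factorial_succ, hd]
    push_cast
    rw [hr]
    field_simp
    ring
  · rw [legendreCoeff_of_not h, legendreCoeff_of_not (l := l + 1) (by omega)]
    rcases l with _ | l
    · simp
    · rw [Nat.add_sub_cancel, legendreCoeff_of_not (l := l) (by omega)]
      simp

theorem pow_eq_sum_legendreCoeff (r : ℕ) (x : ℝ) :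
    x ^ r = ∑ l ∈ Finset.range (r + 1), (2 * l + 1) * legendreCoeff r l * legendreP l x := by
  induction r with
  | zero => simp [legendreCoeff, legendreP_zero]
  | succ r ih =>
    have hx : x ^ (r + 1) = ∑ l ∈ Finset.range (r + 1),
        ((l + 1) * legendreCoeff r l * legendreP (l + 1) x +
          l * legendreCoeff r l * legendreP (l - 1) x) := by
      rw [pow_succ, ih, Finset.sum_mul]
      refine Finset.sum_congr rfl fun l _ => ?_
      linear_combination legendreCoeff r l * legendreP_recurrence l x
    have hup : ∑ l ∈ Finset.range (r + 2), l * legendreCoeff r (l - 1) * legendreP l x =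
        ∑ l ∈ Finset.range (r + 1), (l + 1) * legendreCoeff r l * legendreP (l + 1) x := by
      rw [Finset.sum_range_succ']
      simp
    have hdown : ∑ l ∈ Finset.range (r + 2),
          (l + 1) * legendreCoeff r (l + 1) * legendreP l x =
        ∑ l ∈ Finset.range (r + 1), l * legendreCoeff r l * legendreP (l - 1) x := by
      rw [Finset.sum_range_succ, Finset.sum_range_succ,
        legendreCoeff_of_not (l := r + 1) (by omega),
        legendreCoeff_of_not (l := r + 1 + 1) (by omega), Finset.sum_range_succ']
      simp
    rw [hx, Finset.sum_add_distrib, ← hup, ← hdown, ← Finset.sum_add_distrib]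
    refine Finset.sum_congr rfl fun l _ => ?_
    rw [legendreCoeff_succ]
    ring

/-- For every natural number `r` and real `x`,
`x^r = ∑_l ((2l+1) r!)/(2^((r-l)/2) ((r-l)/2)! (l+r+1)!!) P_l(x)`,
the sum running over `0 ≤ l ≤ r` with `l ≡ r (mod 2)`. -/
theorem power_eq_sum_legendre (r : ℕ) (x : ℝ) :
    x ^ r = ∑ l ∈ Finset.range (r + 1),
      if l % 2 = r % 2 then
        (((2 * l + 1) * r.factorial : ℕ) : ℝ) /
          ((2 ^ ((r - l) / 2) * ((r - l) / 2).factorial *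
            Nat.doubleFactorial (l + r + 1) : ℕ) : ℝ) * legendreP l x
      else 0 := by
  rw [pow_eq_sum_legendreCoeff]
  refine Finset.sum_congr rfl fun l hl => ?_
  have hlr : l ≤ r := Nat.lt_succ_iff.mp (Finset.mem_range.mp hl)
  split_ifs with h
  · rw [legendreCoeff, if_pos ⟨hlr, h⟩]
    push_cast
    ring
  · simp [legendreCoeff_of_not fun h' => h h'.2]
end
end

section
/- For every even natural number s, the series \sum_{r=s/2}^{\infty} 4\pi ((2r)!)^2 / ((1-2r)(r!)^2 4^r \, 2^{r-s/2} (r-s/2)! \,(s+2r+1)!!) converges and its sum equals -\pi\, \Gamma(s/2+1/2)\,\Gamma(s/2-1/2) / (2\,\Gamma(s/2+1)\,\Gamma(s/2+2)). -/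
noncomputable section

open Filter Topology Asymptotics Polynomial
open scoped Nat

/-- The rising factorial as an explicit product. -/
theorem ascPochhammer_eval_eq_prod_range_add (x : ℝ) (n : ℕ) :
    (ascPochhammer ℝ n).eval x = ∏ k ∈ Finset.range n, (x + k) := by
  induction n with
  | zero => simp
  | succ n ih => rw [ascPochhammer_succ_eval, Finset.prod_range_succ, ih]

/-- The rising factorial in terms of Euler's approximation of the Gamma function. -/
theorem ascPochhammer_succ_eval_eq_mul_inv_GammaSeq (x : ℝ) {n : ℕ} (hn : n ≠ 0) :
    (ascPochhammer ℝ (n + 1)).eval x = (n : ℝ) ^ x * n ! * (Real.GammaSeq x n)⁻¹ := by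
  have h : (n : ℝ) ^ x * n ! ≠ 0 := by positivity
  rw [Real.GammaSeq, ascPochhammer_eval_eq_prod_range_add, inv_div, mul_div_cancel₀ _ h]

/-- Euler's limit formula for the reciprocal Gamma function, valid at the poles as well. -/
theorem tendsto_inv_GammaSeq (x : ℝ) :
    Tendsto (fun n => (Real.GammaSeq x n)⁻¹) atTop (𝓝 (Real.Gamma x)⁻¹) := by
  by_cases h : ∃ m : ℕ, x = -m
  · obtain ⟨m, rfl⟩ := h
    rw [Real.Gamma_neg_nat_eq_zero, inv_zero]
    refine tendsto_const_nhds.congr' ?_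
    filter_upwards [eventually_ge_atTop m] with n hn
    rw [Real.GammaSeq, Finset.prod_eq_zero (i := m) (by simp; omega) (by simp)]
    simp
  · push Not at h
    exact (Real.GammaSeq_tendsto_Gamma x).inv₀ (Real.Gamma_ne_zero h)

/-- The coefficients of the Gauss hypergeometric series decay like `n ^ (a + b - c - 1)`. -/
theorem tendsto_rpow_mul_ordinaryHypergeometricCoefficient (a b c : ℝ) :
    Tendsto (fun n : ℕ => (n : ℝ) ^ (c - a - b) *
        ((n + 1 : ℕ) * ordinaryHypergeometricCoefficient a b c (n + 1)))
      atTop (𝓝 ((Real.Gamma a)⁻¹ * (Real.Gamma b)⁻¹ * Real.Gamma c)) := by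
  refine (((tendsto_inv_GammaSeq a).mul (tendsto_inv_GammaSeq b)).mul
    (Real.GammaSeq_tendsto_Gamma c)).congr' ?_
  filter_upwards [eventually_ne_atTop 0] with n hn
  have hn' : (0 : ℝ) < n := by positivity
  simp only [ordinaryHypergeometricCoefficient, ascPochhammer_succ_eval_eq_mul_inv_GammaSeq _ hn,
    Nat.factorial_succ, Real.rpow_sub hn']
  push_cast
  have ha := (Real.rpow_pos_of_pos hn' a).ne'
  have hb := (Real.rpow_pos_of_pos hn' b).ne'
  have hc := (Real.rpow_pos_of_pos hn' c).ne'
  field_simp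

theorem tendsto_natCast_mul_ordinaryHypergeometricCoefficient {a b c : ℝ}
    (habc : 0 < c - a - b) :
    Tendsto (fun n : ℕ => (n : ℝ) * ordinaryHypergeometricCoefficient a b c n) atTop (𝓝 0) := by
  rw [← tendsto_add_atTop_iff_nat 1]
  have h := ((tendsto_rpow_neg_atTop habc).comp tendsto_natCast_atTop_atTop).mul
    (tendsto_rpow_mul_ordinaryHypergeometricCoefficient a b c)
  rw [zero_mul] at h
  refine h.congr' ?_
  filter_upwards [eventually_ne_atTop 0] with n hn
  have hn' : (0 : ℝ) < n := by positivity
  rw [Function.comp_apply, ← mul_assoc, ← Real.rpow_add hn', neg_add_cancel, Real.rpow_zero,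
    one_mul]

theorem summable_ordinaryHypergeometricCoefficient {a b c : ℝ}
    (habc : 0 < c - a - b) : Summable (ordinaryHypergeometricCoefficient a b c) := by
  rw [← summable_nat_add_iff 1]
  refine summable_of_isBigO_nat (g := fun n : ℕ => (n : ℝ) ^ (-(c - a - b) - 1))
    (Real.summable_nat_rpow.2 (by linarith)) ?_
  have h := (tendsto_rpow_mul_ordinaryHypergeometricCoefficient a b c).isBigO_one ℝ
  have h' := (isBigO_refl (fun n : ℕ => (n : ℝ) ^ (-(c - a - b)) * ((n + 1 : ℕ) : ℝ)⁻¹) atTop).mul h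
  refine (h'.congr' ?_ .rfl).trans (IsBigO.of_bound 1 ?_)
  · filter_upwards [eventually_ne_atTop 0] with n hn
    have hn' : (0 : ℝ) < n := by positivity
    have hp := (Real.rpow_pos_of_pos hn' (c - a - b)).ne'
    rw [Real.rpow_neg hn'.le]
    have : ((n + 1 : ℕ) : ℝ) ≠ 0 := by positivity
    field_simp
  · filter_upwards [eventually_ne_atTop 0] with n hn
    have hn' : (0 : ℝ) < n := by positivity
    rw [Real.rpow_sub_one hn'.ne', mul_one, one_mul, div_eq_mul_inv, norm_mul, norm_mul]
    gcongr
    rw [Real.norm_of_nonneg (by positivity), Real.norm_of_nonneg (by positivity)]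
    gcongr
    simp

/-- Gauss's contiguous relation between the values at `1` for the parameters `c` and `c + 1`. -/
theorem tsum_ordinaryHypergeometricCoefficient_contiguous {a b c : ℝ} (hc : 0 < c)
    (habc : 0 < c - a - b) :
    c * (c - a - b) * ∑' n, ordinaryHypergeometricCoefficient a b c n =
      (c - a) * (c - b) * ∑' n, ordinaryHypergeometricCoefficient a b (c + 1) n := by
  have hs := summable_ordinaryHypergeometricCoefficient habc
  have hs' := summable_ordinaryHypergeometricCoefficient (a := a) (b := b) (c := c + 1)
    (by linarith)
  have htel : ∀ n, c * (c - a - b) * ordinaryHypergeometricCoefficient a b c n -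
      (c - a) * (c - b) * ordinaryHypergeometricCoefficient a b (c + 1) n =
      c * (n * ordinaryHypergeometricCoefficient a b c n) -
      c * ((n + 1 : ℕ) * ordinaryHypergeometricCoefficient a b c (n + 1)) := by
    intro n
    have hP := (ascPochhammer_pos n c hc).ne'
    have hcn : c + n ≠ 0 := by positivity
    have hshift : (ascPochhammer ℝ n).eval (c + 1) = (ascPochhammer ℝ n).eval c * (c + n) / c := by
      rw [eq_div_iff hc.ne', ← ascPochhammer_succ_eval, ascPochhammer_succ_left]
      simp [mul_comm]
    simp only [ordinaryHypergeometricCoefficient, hshift, ascPochhammer_succ_eval,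
      Nat.factorial_succ]
    push_cast
    field_simp
    ring
  have hlim := ((hs.hasSum.mul_left (c * (c - a - b))).sub
    (hs'.hasSum.mul_left ((c - a) * (c - b)))).tendsto_sum_nat
  simp only [htel] at hlim
  have hzero := ((tendsto_natCast_mul_ordinaryHypergeometricCoefficient habc).const_mul c).neg
  simp only [mul_zero, neg_zero] at hzero
  refine sub_eq_zero.1 (tendsto_nhds_unique hlim (hzero.congr fun n => ?_))
  rw [Finset.sum_range_sub' (fun n : ℕ => c * (n * ordinaryHypergeometricCoefficient a b c n))]
  simp

theorem tsum_ordinaryHypergeometricCoefficient_shift {a b c : ℝ} (hc : 0 < c)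
    (habc : 0 < c - a - b) (n : ℕ) :
    (ascPochhammer ℝ n).eval c * (ascPochhammer ℝ n).eval (c - a - b) *
        ∑' k, ordinaryHypergeometricCoefficient a b c k =
      (ascPochhammer ℝ n).eval (c - a) * (ascPochhammer ℝ n).eval (c - b) *
        ∑' k, ordinaryHypergeometricCoefficient a b (c + n) k := by
  induction n with
  | zero => simp
  | succ n ih =>
    have h := tsum_ordinaryHypergeometricCoefficient_contiguous (a := a) (b := b) (c := c + n)
      (by positivity) (by linarith [Nat.cast_nonneg (α := ℝ) n])
    simp only [ascPochhammer_succ_eval]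
    push_cast
    rw [← add_assoc]
    linear_combination (c + n) * (c - a - b + n) * ih +
      (ascPochhammer ℝ n).eval (c - a) * (ascPochhammer ℝ n).eval (c - b) * h

theorem tendsto_tsum_ordinaryHypergeometricCoefficient_add_natCast {a b c : ℝ} (hc : 0 < c)
    (habc : 0 < c - a - b) :
    Tendsto (fun n : ℕ => ∑' k, ordinaryHypergeometricCoefficient a b (c + n) k)
      atTop (𝓝 1) := by
  have hone : ∑' k : ℕ, (if k = 0 then (1 : ℝ) else 0) = 1 := by simp
  rw [← hone]
  refine tendsto_tsum_of_dominated_convergence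
    (summable_ordinaryHypergeometricCoefficient habc).norm (fun k => ?_)
    (Eventually.of_forall fun n k => ?_)
  · cases k with
    | zero => simp [ordinaryHypergeometricCoefficient]
    | succ k =>
      rw [if_neg k.succ_ne_zero, ← mul_zero (((k + 1)! : ℝ)⁻¹ *
        (ascPochhammer ℝ (k + 1)).eval a * (ascPochhammer ℝ (k + 1)).eval b)]
      refine Tendsto.const_mul _ (Tendsto.inv_tendsto_atTop ?_)
      refine tendsto_atTop_mono (f := fun n : ℕ => (n : ℝ) * (ascPochhammer ℝ k).eval (c + 1))
        (fun n => ?_) (tendsto_natCast_atTop_atTop.atTop_mul_const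
          (ascPochhammer_pos k (c + 1) (by linarith)))
      rw [ascPochhammer_succ_left]
      simp only [eval_mul, eval_X, eval_comp, eval_add, eval_one,
        ascPochhammer_eval_eq_prod_range_add]
      gcongr
      · linarith
      · linarith [Nat.cast_nonneg (α := ℝ) n]
  · have hP := ascPochhammer_pos k c hc
    simp only [norm_mul, norm_inv]
    refine mul_le_mul_of_nonneg_left (inv_anti₀ (norm_pos_iff.2 hP.ne') ?_) (by positivity)
    simp only [ascPochhammer_eval_eq_prod_range_add, norm_prod]
    refine Finset.prod_le_prod (fun i _ => norm_nonneg _) fun i _ => ?_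
    rw [Real.norm_of_nonneg (by positivity), Real.norm_of_nonneg (by positivity)]
    linarith [Nat.cast_nonneg (α := ℝ) n]

/-- **Gauss's summation theorem** for the hypergeometric series at `1`. -/
theorem hasSum_ordinaryHypergeometricCoefficient {a b c : ℝ} (hc : 0 < c)
    (habc : 0 < c - a - b) :
    HasSum (ordinaryHypergeometricCoefficient a b c)
      (Real.Gamma c * Real.Gamma (c - a - b) / (Real.Gamma (c - a) * Real.Gamma (c - b))) := by
  refine (summable_ordinaryHypergeometricCoefficient habc).hasSum_iff.2 ?_
  have hF := (tendsto_tsum_ordinaryHypergeometricCoefficient_add_natCast hc habc).comp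
    (tendsto_add_atTop_nat 1)
  have hL := ((tendsto_inv_GammaSeq c).mul (tendsto_inv_GammaSeq (c - a - b))).mul_const
    (∑' k, ordinaryHypergeometricCoefficient a b c k)
  have hR := ((tendsto_inv_GammaSeq (c - a)).mul (tendsto_inv_GammaSeq (c - b))).mul hF
  have hLR := tendsto_nhds_unique hL (hR.congr' ?_)
  · have h1 := (Real.Gamma_pos_of_pos hc).ne'
    have h2 := (Real.Gamma_pos_of_pos habc).ne'
    rw [div_eq_mul_inv, mul_inv, ← mul_one ((Real.Gamma (c - a))⁻¹ * _), ← hLR]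
    field_simp
  · filter_upwards [eventually_ne_atTop 0] with n hn
    have hn' : (0 : ℝ) < n := by positivity
    have h := tsum_ordinaryHypergeometricCoefficient_shift hc habc (n + 1)
    simp only [ascPochhammer_succ_eval_eq_mul_inv_GammaSeq _ hn] at h
    have hpow : (n : ℝ) ^ c * (n : ℝ) ^ (c - a - b) = (n : ℝ) ^ (c - a) * (n : ℝ) ^ (c - b) := by
      rw [← Real.rpow_add hn', ← Real.rpow_add hn']
      ring_nf
    have hne : (n : ℝ) ^ (c - a) * (n : ℝ) ^ (c - b) * (n ! : ℝ) ^ 2 ≠ 0 := by positivity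
    refine mul_left_cancel₀ hne ?_
    rw [Function.comp_apply]
    linear_combination -h + (n ! : ℝ) ^ 2 * (Real.GammaSeq c n)⁻¹ *
      (Real.GammaSeq (c - a - b) n)⁻¹ *
      (∑' k, ordinaryHypergeometricCoefficient a b c k) * hpow

theorem Gamma_add_natCast_eq_Gamma_mul_ascPochhammer {x : ℝ} (hx : ∀ k : ℕ, x ≠ -k) (n : ℕ) :
    Real.Gamma (x + n) = Real.Gamma x * (ascPochhammer ℝ n).eval x := by
  induction n with
  | zero => simp
  | succ n ih =>
    have h : x + n ≠ 0 := fun h => hx n (by linarith)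
    rw [ascPochhammer_succ_eval, Nat.cast_succ, ← add_assoc, Real.Gamma_add_one h, ih]
    ring

theorem factorial_two_mul_eq_ascPochhammer (n : ℕ) :
    ((2 * n)! : ℝ) = 4 ^ n * n ! * (ascPochhammer ℝ n).eval (1 / 2) := by
  induction n with
  | zero => simp
  | succ n ih =>
    rw [show 2 * (n + 1) = 2 * n + 1 + 1 by ring]
    simp only [Nat.factorial_succ, ascPochhammer_succ_eval]
    push_cast
    rw [ih]
    ring

theorem doubleFactorial_two_mul_add_one_eq_ascPochhammer (n : ℕ) :
    (Nat.doubleFactorial (2 * n + 1) : ℝ) =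
      2 ^ (n + 1) * (ascPochhammer ℝ (n + 1)).eval (1 / 2) := by
  induction n with
  | zero => simp
  | succ n ih =>
    rw [show 2 * (n + 1) + 1 = 2 * n + 1 + 2 by ring, Nat.doubleFactorial_add_two,
      ascPochhammer_succ_eval]
    push_cast
    rw [ih]
    ring

theorem ascPochhammer_eval_half_eq_neg_half (n : ℕ) :
    (ascPochhammer ℝ n).eval (1 / 2) = (1 - 2 * n) * (ascPochhammer ℝ n).eval (-1 / 2 : ℝ) := by
  induction n with
  | zero => simp
  | succ n ih =>
    simp only [ascPochhammer_succ_eval]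
    push_cast
    rw [ih]
    ring

theorem ascPochhammer_add_eval (x : ℝ) (m n : ℕ) :
    (ascPochhammer ℝ (m + n)).eval x =
      (ascPochhammer ℝ m).eval x * (ascPochhammer ℝ n).eval (x + m) := by
  rw [← ascPochhammer_mul]
  simp

/-- For every even natural number `s`, the series
`∑_{r=s/2}^∞ 4π ((2r)!)² / ((1-2r)(r!)² 4^r 2^(r-s/2) (r-s/2)! (s+2r+1)!!)`
converges, with sum `-π Γ(s/2+1/2) Γ(s/2-1/2) / (2 Γ(s/2+1) Γ(s/2+2))`.
(The series is reindexed by `r = s/2 + j`, `j ∈ ℕ`.) -/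
theorem onsager_eigenvalue_closed_form (s : ℕ) (hs : Even s) :
    HasSum
      (fun j : ℕ =>
        4 * Real.pi * (((2 * (s / 2 + j)).factorial : ℝ)) ^ 2 /
          ((1 - 2 * ((s / 2 + j : ℕ) : ℝ)) * ((s / 2 + j).factorial : ℝ) ^ 2 *
            4 ^ (s / 2 + j) * 2 ^ j * (j.factorial : ℝ) *
            (Nat.doubleFactorial (s + 2 * (s / 2 + j) + 1) : ℝ)))
      (-(Real.pi * Real.Gamma ((s : ℝ) / 2 + 1 / 2) * Real.Gamma ((s : ℝ) / 2 - 1 / 2)) /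
        (2 * Real.Gamma ((s : ℝ) / 2 + 1) * Real.Gamma ((s : ℝ) / 2 + 2))) := by
  obtain ⟨m, rfl⟩ := hs
  have hm : (m + m) / 2 = m := by omega
  have hcast : ((m + m : ℕ) : ℝ) / 2 = m := by push_cast; ring
  rw [hm, hcast]
  have hhalf : ∀ k : ℕ, (1 / 2 : ℝ) ≠ -k := fun k h => by
    linarith [Nat.cast_nonneg (α := ℝ) k]
  have hneg : ∀ k : ℕ, (-1 / 2 : ℝ) ≠ -k := fun k h => by
    have h2 : (1 : ℝ) = 2 * k := by linarith
    norm_cast at h2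
    omega
  have hP : ∀ n, (ascPochhammer ℝ n).eval (1 / 2 : ℝ) ≠ 0 := fun n =>
    (ascPochhammer_pos n _ (by norm_num)).ne'
  have h := (hasSum_ordinaryHypergeometricCoefficient (a := m + 1 / 2) (b := m - 1 / 2)
    (c := 2 * m + 3 / 2) (by positivity) (by ring_nf; norm_num)).mul_left
    (2 * Real.pi * (ascPochhammer ℝ m).eval (1 / 2) * (ascPochhammer ℝ m).eval (-1 / 2 : ℝ) /
      (ascPochhammer ℝ (2 * m + 1)).eval (1 / 2))
  convert! h using 1
  · funext j
    have hodd : (1 - 2 * ((m + j : ℕ) : ℝ)) ≠ 0 := fun h => by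
      have h2 : (1 : ℝ) = 2 * (m + j : ℕ) := by linarith
      norm_cast at h2
      omega
    have e1 := ascPochhammer_add_eval (1 / 2) m j
    have e2 := ascPochhammer_add_eval (-1 / 2) m j
    have e3 := ascPochhammer_add_eval (1 / 2) (2 * m + 1) j
    rw [show (1 / 2 : ℝ) + m = m + 1 / 2 by ring] at e1
    rw [show (-1 / 2 : ℝ) + m = m - 1 / 2 by ring] at e2
    rw [show (1 / 2 : ℝ) + (2 * m + 1 : ℕ) = 2 * m + 3 / 2 by push_cast; ring] at e3
    have hc := (ascPochhammer_pos j (2 * m + 3 / 2 : ℝ) (by positivity)).ne'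
    have e4 := ascPochhammer_eval_half_eq_neg_half (m + j)
    rw [show m + m + 2 * (m + j) + 1 = 2 * (2 * m + j) + 1 by ring,
      doubleFactorial_two_mul_add_one_eq_ascPochhammer, factorial_two_mul_eq_ascPochhammer,
      show 2 * m + j + 1 = 2 * m + 1 + j by ring, e3]
    have hd := hP (2 * m + 1)
    have hfour : (4 : ℝ) ^ (m + j) = 2 ^ (2 * m + j) * 2 ^ j := by
      rw [show (4 : ℝ) = 2 ^ 2 by norm_num, ← pow_mul, ← pow_add]
      ring_nf
    have hsq : (ascPochhammer ℝ (m + j)).eval (1 / 2 : ℝ) ^ 2 =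
        (1 - 2 * ((m + j : ℕ) : ℝ)) * ((ascPochhammer ℝ m).eval (1 / 2 : ℝ) *
          (ascPochhammer ℝ j).eval (m + 1 / 2 : ℝ)) * ((ascPochhammer ℝ m).eval (-1 / 2 : ℝ) *
          (ascPochhammer ℝ j).eval (m - 1 / 2 : ℝ)) := by
      rw [← e1, ← e2, sq]
      nth_rewrite 2 [e4]
      ring
    rw [mul_pow, mul_pow, hsq, hfour, show 2 * m + 1 + j = 2 * m + j + 1 by ring, pow_succ]
    generalize 1 - 2 * ((m + j : ℕ) : ℝ) = q at hodd ⊢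
    rw [ordinaryHypergeometricCoefficient]
    field_simp
    ring
  · have g1 := Gamma_add_natCast_eq_Gamma_mul_ascPochhammer hhalf m
    have g2 := Gamma_add_natCast_eq_Gamma_mul_ascPochhammer hneg m
    have g3 := Gamma_add_natCast_eq_Gamma_mul_ascPochhammer hhalf (2 * m + 1)
    have g4 : Real.Gamma (1 / 2) = -1 / 2 * Real.Gamma (-1 / 2) := by
      rw [← Real.Gamma_add_one (by norm_num)]
      norm_num
    have g5 : Real.Gamma (3 / 2) = 1 / 2 * Real.Gamma (1 / 2) := by
      rw [← Real.Gamma_add_one (by norm_num)]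
      norm_num
    have hn := Real.Gamma_ne_zero hneg
    have hd := hP (2 * m + 1)
    rw [show (2 * m + 3 / 2 : ℝ) - (m + 1 / 2) - (m - 1 / 2) = 3 / 2 by ring,
      show (2 * m + 3 / 2 : ℝ) - (m + 1 / 2) = m + 1 by ring,
      show (2 * m + 3 / 2 : ℝ) - (m - 1 / 2) = m + 2 by ring,
      show (2 * m + 3 / 2 : ℝ) = 1 / 2 + (2 * m + 1 : ℕ) by push_cast; ring,
      show (m + 1 / 2 : ℝ) = 1 / 2 + m by ring,
      show (m - 1 / 2 : ℝ) = -1 / 2 + m by ring, g1, g2, g3, g5, g4]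
    have h1 := (Real.Gamma_pos_of_pos (show (0 : ℝ) < m + 1 by positivity)).ne'
    have h2 := (Real.Gamma_pos_of_pos (show (0 : ℝ) < m + 2 by positivity)).ne'
    field_simp
end
end

section
/- Define, for natural numbers l \le r, c_l^r = 4\pi ((2r)!)^2 / ((1-2r)(r!)^2 4^r \, 2^{r-l} (r-l)! \,(2l+2r+1)!!). Then the double series \sum_{l=0}^{\infty} \sum_{r=l}^{\infty} (4l+1)^{3/2} |c_l^r| is finite. -/
noncomputable section

/-- The coefficients `c_l^r` in the spherical-harmonic expansion of the Onsager kernel,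
for `l ≤ r`. -/
def cOnsager (l r : ℕ) : ℝ :=
  4 * Real.pi * (((2 * r).factorial : ℝ)) ^ 2 /
    ((1 - 2 * (r : ℝ)) * ((r.factorial : ℝ)) ^ 2 * 4 ^ r * 2 ^ (r - l) *
      ((r - l).factorial : ℝ) * (Nat.doubleFactorial (2 * l + 2 * r + 1) : ℝ))

/-- The reciprocal of the `l`-dependent part of the denominator of `cOnsager l r`,
extended by zero to `l > r`. -/
def onsagerWeight (r l : ℕ) : ℝ :=
  if l ≤ r then
    ((2 : ℝ) ^ (r - l) * ((r - l).factorial : ℝ) *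
      (Nat.doubleFactorial (2 * l + 2 * r + 1) : ℝ))⁻¹
  else 0

/-- The factor `((2r - 1)!!)²` of `cOnsager l r`. -/
def onsagerScale (r : ℕ) : ℝ :=
  ((2 * r).factorial : ℝ) ^ 2 / ((r.factorial : ℝ) ^ 2 * 4 ^ r)

lemma onsagerWeight_nonneg (r l : ℕ) : 0 ≤ onsagerWeight r l := by
  unfold onsagerWeight
  split_ifs <;> positivity

lemma onsagerScale_nonneg (r : ℕ) : 0 ≤ onsagerScale r := by
  unfold onsagerScale
  positivity

lemma onsagerWeight_succ (r l : ℕ) :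
    onsagerWeight r (l + 1) * (2 * l + 2 * r + 3) = onsagerWeight r l * (2 * r - 2 * l) := by
  unfold onsagerWeight
  rcases lt_trichotomy l r with h | rfl | h
  · obtain ⟨k, rfl⟩ := Nat.exists_eq_add_of_lt h
    have hk : l + k + 1 - l = k + 1 := by omega
    have hk' : l + k + 1 - (l + 1) = k := by omega
    have hd : 2 * (l + 1) + 2 * (l + k + 1) + 1 = (2 * l + 2 * (l + k + 1) + 1) + 2 := by ring
    rw [if_pos (by omega), if_pos (by omega), hk, hk', hd, Nat.doubleFactorial_add_two,
      Nat.factorial_succ, pow_succ]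
    have hpos : (0 : ℝ) < (Nat.doubleFactorial (2 * l + 2 * (l + k + 1) + 1) : ℝ) := by
      exact_mod_cast Nat.doubleFactorial_pos _
    have hfac : (0 : ℝ) < (k.factorial : ℝ) := by exact_mod_cast k.factorial_pos
    push_cast
    field_simp
    ring
  · simp
  · rw [if_neg (by omega), if_neg (by omega)]
    simp

lemma sum_mul_onsagerWeight (r n : ℕ) :
    ∑ l ∈ Finset.range n, (4 * l + 1 : ℝ) * onsagerWeight r l =
      (2 * r + 1) * onsagerWeight r 0 - (2 * n + 2 * r + 1) * onsagerWeight r n := by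
  induction n with
  | zero => simp
  | succ n ih =>
    rw [Finset.sum_range_succ, ih]
    push_cast
    linear_combination onsagerWeight_succ r n

lemma sum_cube_mul_onsagerWeight (r n : ℕ) :
    ∑ l ∈ Finset.range n, (4 * l + 1 : ℝ) ^ 3 * onsagerWeight r l =
      (16 * r + 1) * (2 * r + 1) * onsagerWeight r 0 -
        ((4 * n - 1) ^ 2 + 16 * r) * (2 * n + 2 * r + 1) * onsagerWeight r n := by
  induction n with
  | zero => simp; ring
  | succ n ih =>
    rw [Finset.sum_range_succ, ih]
    push_cast
    linear_combination ((4 * n + 3 : ℝ) ^ 2 + 16 * r) * onsagerWeight_succ r n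

lemma onsagerWeight_succ_self (r : ℕ) : onsagerWeight r (r + 1) = 0 := by
  simp [onsagerWeight]

/-- The Wallis ratio `(2r - 1)!! / (2r)!!`. -/
def wallisRatio (r : ℕ) : ℝ := onsagerScale r * ((2 * r + 1) * onsagerWeight r 0)

lemma wallisRatio_nonneg (r : ℕ) : 0 ≤ wallisRatio r := by
  have h₁ := onsagerScale_nonneg r
  have h₂ := onsagerWeight_nonneg r 0
  unfold wallisRatio
  positivity

lemma wallisRatio_succ (r : ℕ) :
    wallisRatio (r + 1) = wallisRatio r * ((2 * r + 1) / (2 * r + 2)) := by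
  simp only [wallisRatio, onsagerScale, onsagerWeight, zero_le, if_true, Nat.sub_zero, mul_zero,
    zero_add]
  have hd : 2 * (r + 1) + 1 = (2 * r + 1) + 2 := by ring
  have hf : 2 * (r + 1) = (2 * r + 1) + 1 := by ring
  rw [hd, hf, Nat.doubleFactorial_add_two, Nat.factorial_succ, Nat.factorial_succ,
    Nat.factorial_succ, pow_succ, pow_succ]
  have hpos : (0 : ℝ) < (Nat.doubleFactorial (2 * r + 1) : ℝ) := by
    exact_mod_cast Nat.doubleFactorial_pos _
  have hfac : (0 : ℝ) < (r.factorial : ℝ) := by exact_mod_cast r.factorial_pos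
  push_cast
  field_simp
  ring

lemma wallisRatio_sq_mul_le (r : ℕ) : wallisRatio r ^ 2 * (2 * r + 1) ≤ 1 := by
  induction r with
  | zero => simp [wallisRatio, onsagerScale, onsagerWeight]
  | succ r ih =>
    refine le_trans ?_ ih
    rw [wallisRatio_succ, mul_pow, mul_assoc]
    refine mul_le_mul_of_nonneg_left ?_ (sq_nonneg _)
    push_cast
    rw [div_pow, div_mul_eq_mul_div, div_le_iff₀ (by positivity)]
    nlinarith [(Nat.cast_nonneg r : (0 : ℝ) ≤ r)]

lemma wallisRatio_le (r : ℕ) : wallisRatio r ≤ (2 * r + 1 : ℝ) ^ (-(1 / 2) : ℝ) := by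
  have hr : (0 : ℝ) < 2 * r + 1 := by positivity
  rw [Real.rpow_neg hr.le, ← Real.sqrt_eq_rpow, ← Real.sqrt_inv]
  refine Real.le_sqrt_of_sq_le ?_
  rw [inv_eq_one_div, le_div_iff₀ hr]
  exact wallisRatio_sq_mul_le r

lemma abs_cOnsager {l r : ℕ} (h : l ≤ r) :
    |cOnsager l r| = 4 * Real.pi / |1 - 2 * (r : ℝ)| * (onsagerScale r * onsagerWeight r l) := by
  have hc : cOnsager l r =
      4 * Real.pi / (1 - 2 * (r : ℝ)) * (onsagerScale r * onsagerWeight r l) := by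
    rw [cOnsager, onsagerScale, onsagerWeight, if_pos h]
    simp only [div_eq_mul_inv, mul_inv]
    ring
  rw [hc, abs_mul, abs_div, abs_of_nonneg (by positivity : (0 : ℝ) ≤ 4 * Real.pi),
    abs_of_nonneg (mul_nonneg (onsagerScale_nonneg r) (onsagerWeight_nonneg r l))]

lemma rpow_three_halves_le {x s : ℝ} (hx : 0 ≤ x) (hs : 0 < s) :
    x ^ ((3 : ℝ) / 2) ≤ s * x + x ^ 3 / s ^ 3 := by
  have hsplit : x ^ ((3 : ℝ) / 2) = x * √x := by
    rw [Real.sqrt_eq_rpow, show (3 : ℝ) / 2 = 1 + 1 / 2 by norm_num,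
      Real.rpow_add_of_nonneg hx (by norm_num) (by norm_num), Real.rpow_one]
  have hle : √x ≤ s + x ^ 2 / s ^ 3 := by
    rcases le_total (√x) s with h | h
    · have : 0 ≤ x ^ 2 / s ^ 3 := by positivity
      linarith
    · have h₁ : √x ≤ x ^ 2 / s ^ 3 := by
        rw [le_div_iff₀ (by positivity)]
        calc √x * s ^ 3 ≤ √x * √x ^ 3 := by gcongr
          _ = (√x ^ 2) ^ 2 := by ring
          _ = x ^ 2 := by rw [Real.sq_sqrt hx]
      linarith
  calc x ^ ((3 : ℝ) / 2) = x * √x := hsplit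
    _ ≤ x * (s + x ^ 2 / s ^ 3) := by gcongr
    _ = s * x + x ^ 3 / s ^ 3 := by ring

lemma sum_rpow_mul_onsagerWeight_le (r : ℕ) :
    onsagerScale r * ∑ l ∈ Finset.range (r + 1),
      (4 * l + 1 : ℝ) ^ ((3 : ℝ) / 2) * onsagerWeight r l ≤
        9 * (2 * r + 1 : ℝ) ^ (-(1 / 4) : ℝ) := by
  have hr : (0 : ℝ) < 2 * r + 1 := by positivity
  set s : ℝ := (2 * r + 1 : ℝ) ^ ((1 : ℝ) / 4) with hs_def
  have hs : 0 < s := Real.rpow_pos_of_pos hr _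
  have hs4 : s ^ 4 = 2 * r + 1 := by
    rw [hs_def, ← Real.rpow_natCast, ← Real.rpow_mul hr.le]
    norm_num
  have hsum : ∑ l ∈ Finset.range (r + 1), (4 * l + 1 : ℝ) ^ ((3 : ℝ) / 2) * onsagerWeight r l ≤
      s * ((2 * r + 1) * onsagerWeight r 0) +
        (16 * r + 1) * (2 * r + 1) * onsagerWeight r 0 / s ^ 3 := by
    have h₁ := sum_mul_onsagerWeight r (r + 1)
    have h₃ := sum_cube_mul_onsagerWeight r (r + 1)
    rw [onsagerWeight_succ_self, mul_zero, sub_zero] at h₁ h₃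
    rw [← h₁, ← h₃, Finset.mul_sum, Finset.sum_div, ← Finset.sum_add_distrib]
    refine Finset.sum_le_sum fun l _ => ?_
    calc _ ≤ (s * (4 * l + 1 : ℝ) + (4 * l + 1 : ℝ) ^ 3 / s ^ 3) * onsagerWeight r l :=
          mul_le_mul_of_nonneg_right (rpow_three_halves_le (by positivity) hs)
            (onsagerWeight_nonneg r l)
      _ = _ := by ring
  calc _ ≤ onsagerScale r * (s * ((2 * r + 1) * onsagerWeight r 0) +
        (16 * r + 1) * (2 * r + 1) * onsagerWeight r 0 / s ^ 3) :=
        mul_le_mul_of_nonneg_left hsum (onsagerScale_nonneg r)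
    _ = wallisRatio r * (s + (16 * r + 1) / s ^ 3) := by
        unfold wallisRatio
        ring
    _ ≤ wallisRatio r * (9 * s) := by
        refine mul_le_mul_of_nonneg_left ?_ (wallisRatio_nonneg r)
        have : (16 * r + 1) / s ^ 3 ≤ 8 * s := by
          rw [div_le_iff₀ (by positivity)]
          nlinarith
        linarith
    _ ≤ (2 * r + 1 : ℝ) ^ (-(1 / 2) : ℝ) * (9 * s) := by
        gcongr
        exact wallisRatio_le r
    _ = 9 * (2 * r + 1 : ℝ) ^ (-(1 / 4) : ℝ) := by
        rw [hs_def, mul_left_comm, ← Real.rpow_add hr]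
        norm_num

lemma sum_rpow_mul_abs_cOnsager_le (r : ℕ) :
    ∑ l ∈ Finset.range (r + 1), (4 * l + 1 : ℝ) ^ ((3 : ℝ) / 2) * |cOnsager l r| ≤
      108 * Real.pi * (r + 1 : ℝ) ^ (-(5 / 4) : ℝ) := by
  have hr : (0 : ℝ) < 2 * r + 1 := by positivity
  have habs : (2 * r + 1 : ℝ) / 3 ≤ |1 - 2 * (r : ℝ)| := by
    rcases Nat.eq_zero_or_pos r with rfl | h
    · norm_num
    · have h₁ : (1 : ℝ) ≤ r := by exact_mod_cast h
      rw [abs_sub_comm, abs_of_nonneg (by linarith)]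
      linarith
  calc _ = 4 * Real.pi / |1 - 2 * (r : ℝ)| * (onsagerScale r * ∑ l ∈ Finset.range (r + 1),
          (4 * l + 1 : ℝ) ^ ((3 : ℝ) / 2) * onsagerWeight r l) := by
        rw [Finset.mul_sum, Finset.mul_sum]
        refine Finset.sum_congr rfl fun l hl => ?_
        rw [abs_cOnsager (Nat.lt_succ_iff.mp (Finset.mem_range.mp hl))]
        ring
    _ ≤ 4 * Real.pi / ((2 * r + 1 : ℝ) / 3) * (9 * (2 * r + 1 : ℝ) ^ (-(1 / 4) : ℝ)) := by
        refine mul_le_mul (by gcongr) (sum_rpow_mul_onsagerWeight_le r) ?_ (by positivity)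
        exact mul_nonneg (onsagerScale_nonneg r) (Finset.sum_nonneg fun l _ =>
          mul_nonneg (by positivity) (onsagerWeight_nonneg r l))
    _ = 108 * Real.pi * (2 * r + 1 : ℝ) ^ (-(5 / 4) : ℝ) := by
        rw [show (-(5 / 4) : ℝ) = -(1 / 4) - 1 by norm_num, Real.rpow_sub_one hr.ne']
        field_simp
        norm_num
    _ ≤ 108 * Real.pi * (r + 1 : ℝ) ^ (-(5 / 4) : ℝ) := by
        refine mul_le_mul_of_nonneg_left ?_ (by positivity)
        refine Real.rpow_le_rpow_of_nonpos (by positivity) ?_ (by norm_num)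
        linarith [(Nat.cast_nonneg r : (0 : ℝ) ≤ r)]

/-- The double series `∑_{l=0}^∞ ∑_{r=l}^∞ (4l+1)^(3/2) |c_l^r|` is finite. -/
theorem onsager_coefficients_summable :
    Summable (fun q : ℕ × ℕ =>
      if q.1 ≤ q.2 then ((4 * q.1 + 1 : ℝ)) ^ ((3 : ℝ) / 2) * |cOnsager q.1 q.2| else 0) := by
  rw [← (Equiv.prodComm ℕ ℕ).summable_iff]
  have hzero : ∀ r l : ℕ, l ∉ Finset.range (r + 1) →
      (if l ≤ r then ((4 * l + 1 : ℝ)) ^ ((3 : ℝ) / 2) * |cOnsager l r| else 0) = 0 :=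
    fun r l hl => if_neg fun h => hl (Finset.mem_range.mpr (Nat.lt_succ_of_le h))
  have hnonneg : ∀ r l : ℕ, 0 ≤
      (if l ≤ r then ((4 * l + 1 : ℝ)) ^ ((3 : ℝ) / 2) * |cOnsager l r| else 0) := by
    intro r l
    split_ifs <;> positivity
  refine (summable_prod_of_nonneg fun p => hnonneg p.1 p.2).mpr
    ⟨fun r => summable_of_ne_finset_zero (s := Finset.range (r + 1)) (hzero r), ?_⟩
  refine Summable.of_nonneg_of_le (fun r => tsum_nonneg (hnonneg r)) (fun r => ?_)
    (Summable.mul_left (108 * Real.pi) (f := fun r : ℕ => (r + 1 : ℝ) ^ (-(5 / 4) : ℝ)) ?_)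
  · refine le_of_eq_of_le ?_ (sum_rpow_mul_abs_cOnsager_le r)
    refine (tsum_eq_sum (hzero r)).trans (Finset.sum_congr rfl fun l hl => ?_)
    exact if_pos (Nat.lt_succ_iff.mp (Finset.mem_range.mp hl))
  · have h : Summable fun n : ℕ => (n : ℝ) ^ (-(5 / 4) : ℝ) :=
      Real.summable_nat_rpow.mpr (by norm_num)
    exact_mod_cast (summable_nat_add_iff 1).mpr h
end
end

section
/- For every integer l \ge 1, \Gamma(l+1/2)\,\Gamma(l-1/2) / (\Gamma(l+1)\,\Gamma(l+2)) < 1/l^3; consequently the Onsager eigenvalues satisfy |\mu_O(2l)| < \pi/(2 l^3) for all l \ge 1, i.e. they decay faster than l^{-3}. -/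
noncomputable section

/-- Log-convexity of `Γ` at the midpoint of `[x, x + 1]`. -/
theorem mul_Gamma_add_half_sq_le {x : ℝ} (hx : 0 < x) :
    x * Real.Gamma (x + 1 / 2) ^ 2 ≤ Real.Gamma (x + 1) ^ 2 := by
  have hG := Real.Gamma_pos_of_pos hx
  have h := Real.Gamma_mul_add_mul_le_rpow_Gamma_mul_rpow_Gamma (s := x) (t := x + 1)
    (a := 1 / 2) (b := 1 / 2) hx (by linarith) (by norm_num) (by norm_num) (by norm_num)
  rw [show 1 / 2 * x + 1 / 2 * (x + 1) = x + 1 / 2 by ring, ← Real.sqrt_eq_rpow,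
    ← Real.sqrt_eq_rpow] at h
  have h2 := pow_le_pow_left₀ (Real.Gamma_pos_of_pos (by linarith)).le h 2
  rw [mul_pow, Real.sq_sqrt hG.le, Real.sq_sqrt (Real.Gamma_pos_of_pos (by linarith)).le,
    Real.Gamma_add_one hx.ne'] at h2
  rw [Real.Gamma_add_one hx.ne']
  calc x * Real.Gamma (x + 1 / 2) ^ 2 ≤ x * (Real.Gamma x * (x * Real.Gamma x)) := by gcongr
    _ = (x * Real.Gamma x) ^ 2 := by ring

theorem gamma_ratio_lt (l : ℕ) (hl : 1 ≤ l) :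
    Real.Gamma ((l : ℝ) + 1 / 2) * Real.Gamma ((l : ℝ) - 1 / 2) /
      (Real.Gamma ((l : ℝ) + 1) * Real.Gamma ((l : ℝ) + 2)) < 1 / (l : ℝ) ^ 3 := by
  have hl' : (1 : ℝ) ≤ l := by exact_mod_cast hl
  have hG := Real.Gamma_pos_of_pos (show (0 : ℝ) < l + 1 by linarith)
  have hH := Real.Gamma_pos_of_pos (show (0 : ℝ) < l + 1 / 2 by linarith)
  have hK := Real.Gamma_pos_of_pos (show (0 : ℝ) < l - 1 / 2 by linarith)
  have h2 : Real.Gamma ((l : ℝ) + 2) = (l + 1) * Real.Gamma ((l : ℝ) + 1) := by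
    rw [← Real.Gamma_add_one (by linarith)]; congr 1; ring
  have hhalf : Real.Gamma ((l : ℝ) + 1 / 2) = (l - 1 / 2) * Real.Gamma ((l : ℝ) - 1 / 2) := by
    rw [← Real.Gamma_add_one (by linarith)]; congr 1; ring
  rw [h2, div_lt_div_iff₀ (by positivity) (by positivity), one_mul]
  rcases hl.eq_or_lt with rfl | hl1
  · have hK' : Real.Gamma ((1 : ℝ) - 1 / 2) = √Real.pi := by
      rw [← Real.Gamma_one_half_eq]; norm_num
    push_cast at hhalf hG ⊢
    rw [hhalf, hK', show (1 : ℝ) + 1 = 2 by norm_num, Real.Gamma_two]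
    nlinarith [Real.sq_sqrt Real.pi_pos.le, Real.pi_lt_four]
  · have hl2 : (2 : ℝ) ≤ l := by exact_mod_cast hl1
    have h := mul_Gamma_add_half_sq_le (x := l) (by linarith)
    have hlt : (l : ℝ) ^ 2 < (l - 1 / 2) * (l + 1) := by nlinarith
    have hp : (0 : ℝ) < l - 1 / 2 := by linarith
    refine lt_of_mul_lt_mul_left ?_ hp.le
    calc (l - 1 / 2 : ℝ) * (Real.Gamma (l + 1 / 2) * Real.Gamma (l - 1 / 2) * (l : ℝ) ^ 3)
        = l ^ 2 * (l * Real.Gamma (l + 1 / 2) ^ 2) := by rw [hhalf]; ring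
      _ ≤ l ^ 2 * Real.Gamma (l + 1) ^ 2 := by gcongr
      _ < (l - 1 / 2) * (l + 1) * Real.Gamma (l + 1) ^ 2 := by gcongr
      _ = _ := by ring

/-- For every integer `l ≥ 1`, `Γ(l+1/2)Γ(l-1/2)/(Γ(l+1)Γ(l+2)) < 1/l³`, and consequently
the Onsager eigenvalues `μ_O(2l) = -π Γ(l+1/2)Γ(l-1/2)/(2Γ(l+1)Γ(l+2))` satisfy
`|μ_O(2l)| < π/(2l³)`. -/
theorem gamma_ratio_lt_and_onsager_eigenvalue_decay (l : ℕ) (hl : 1 ≤ l) :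
    Real.Gamma ((l : ℝ) + 1 / 2) * Real.Gamma ((l : ℝ) - 1 / 2) /
        (Real.Gamma ((l : ℝ) + 1) * Real.Gamma ((l : ℝ) + 2)) < 1 / (l : ℝ) ^ 3 ∧
    |(-(Real.pi * Real.Gamma (((2 * l : ℕ) : ℝ) / 2 + 1 / 2) *
          Real.Gamma (((2 * l : ℕ) : ℝ) / 2 - 1 / 2)) /
        (2 * Real.Gamma (((2 * l : ℕ) : ℝ) / 2 + 1) *
          Real.Gamma (((2 * l : ℕ) : ℝ) / 2 + 2)))| < Real.pi / (2 * (l : ℝ) ^ 3) := by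
  have key := gamma_ratio_lt l hl
  refine ⟨key, ?_⟩
  have hl' : (1 : ℝ) ≤ l := by exact_mod_cast hl
  have hG := Real.Gamma_pos_of_pos (show (0 : ℝ) < l + 1 by linarith)
  have hG' := Real.Gamma_pos_of_pos (show (0 : ℝ) < l + 2 by linarith)
  have hH := Real.Gamma_pos_of_pos (show (0 : ℝ) < l + 1 / 2 by linarith)
  have hK := Real.Gamma_pos_of_pos (show (0 : ℝ) < l - 1 / 2 by linarith)
  rw [show ((2 * l : ℕ) : ℝ) / 2 = l by push_cast; ring, neg_div, abs_neg,
    abs_of_pos (by positivity)]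
  have h := mul_lt_mul_of_pos_left key (show 0 < Real.pi / 2 by positivity)
  refine (Eq.trans_lt ?_ h).trans_eq ?_ <;> ring
end
end

section
/- Let (a_r)_{r\ge 0} be real numbers such that the power series \sum_{r=0}^{\infty} a_r x^r converges for all |x| < 1 to a function k, and assume the summability condition \sum_{l=0}^{\infty} \sum_{r=l, l+2, l+4, \dots} | 4\pi (4l+1)^{3/2} a_r r! / (2^{(r-l)/2} ((r-l)/2)! (l+r+1)!!) | < \infty. Then for every natural number s, every integer n with |n| \le s, and every p \in S^2, \int_{S^2} k(p\cdot q)\, Y_s^n(q)\, dq = \mu_s \, Y_s^n(p), where \mu_s = \sum_{r=0}^{\infty} 4\pi a_{s+2r} (s+2r)! / (2^r r! (2s+2r+1)!!); that is, each spherical harmonic Y_s^n is an eigenfunction of the integral operator with kernel k(p\cdot q), with eigenvalue \mu_s. -/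
open MeasureTheory

noncomputable section

/-- The unit sphere `S²` in `ℝ³`. -/
abbrev S2 := Metric.sphere (0 : EuclideanSpace ℝ (Fin 3)) 1

/-- The surface measure on `S²` (of total mass `4π`). -/
def sphereMeasure : Measure S2 := (volume : Measure (EuclideanSpace ℝ (Fin 3))).toSphere

/-- The associated Legendre function
`P_l^m(μ) = (1/(2^l l!)) (1−μ²)^(m/2) (d^(l+m)/dμ^(l+m))(μ²−1)^l`. -/
def assocLegendre (l : ℕ) (m : ℤ) (x : ℝ) : ℝ :=
  (1 / (2 ^ l * (l.factorial : ℝ))) * (1 - x ^ 2) ^ ((m : ℝ) / 2) *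
    iteratedDeriv ((l : ℤ) + m).toNat (fun y : ℝ => (y ^ 2 - 1) ^ l) x

/-- The normalisation constant `N_{lm} = (−1)^m ((2l+1)/(4π))^(1/2) ((l−m)!/(l+m)!)^(1/2)`. -/
def sphNormal (l : ℕ) (m : ℤ) : ℝ :=
  (-1 : ℝ) ^ m * Real.sqrt ((2 * l + 1) / (4 * Real.pi)) *
    Real.sqrt (((((l : ℤ) - m).toNat.factorial : ℝ)) / ((((l : ℤ) + m).toNat.factorial : ℝ)))

/-- The azimuthal angle `φ` of a point of `S²`. -/
def azimuth (p : S2) : ℝ :=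
  Complex.arg ⟨(p : EuclideanSpace ℝ (Fin 3)) 0, (p : EuclideanSpace ℝ (Fin 3)) 1⟩

/-- The spherical harmonic `Y_l^m : S² → ℂ`, `Y_l^m(φ,θ) = N_{lm} e^{imφ} P_l^m(cos θ)`,
where `cos θ` is the third coordinate of the point. -/
def sphHarm (l : ℕ) (m : ℤ) (p : S2) : ℂ :=
  (sphNormal l m : ℂ) * Complex.exp (Complex.I * m * azimuth p) *
    (assocLegendre l m ((p : EuclideanSpace ℝ (Fin 3)) 2) : ℂ)


section GaussianMoments

variable {V : Type*} [NormedAddCommGroup V]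

/-- The unnormalised Gaussian weight `exp (-‖x‖² / 2)`, as a complex number. -/
def gaussWeight (x : V) : ℂ := (Real.exp (-‖x‖ ^ 2 / 2) : ℝ)

lemma continuous_gaussWeight : Continuous (gaussWeight : V → ℂ) := by
  unfold gaussWeight
  fun_prop

variable [InnerProductSpace ℝ V]

lemma hasLineDerivAt_gaussWeight (x v : V) :
    HasLineDerivAt ℝ gaussWeight (-(inner ℝ v x : ℂ) * gaussWeight x) x v := by
  have h : HasDerivAt (fun t : ℝ => Real.exp (-(‖x‖ ^ 2 + 2 * t * inner ℝ v x + t ^ 2 * ‖v‖ ^ 2) / 2))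
      (-(inner ℝ v x) * Real.exp (-‖x‖ ^ 2 / 2)) 0 := by
    have h1 : HasDerivAt (fun t : ℝ => -(‖x‖ ^ 2 + 2 * t * inner ℝ v x + t ^ 2 * ‖v‖ ^ 2) / 2)
        (-(inner ℝ v x)) 0 := by
      have h2 := ((((hasDerivAt_id (0 : ℝ)).const_mul (2 : ℝ)).mul_const (inner ℝ v x)).const_add
        (‖x‖ ^ 2)).add (((hasDerivAt_id (0 : ℝ)).pow 2).mul_const (‖v‖ ^ 2))
      convert! (h2.neg.div_const 2) using 1
      simp only [id_eq, Nat.cast_ofNat]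
      ring
    convert! h1.exp using 1
    simp [mul_comm]
  unfold HasLineDerivAt
  convert! h.ofReal_comp using 1
  · ext t
    simp only [gaussWeight]
    rw [norm_add_sq_real, norm_smul, inner_smul_right, mul_pow, Real.norm_eq_abs, sq_abs,
      real_inner_comm x v]
    congr 3
    ring
  · simp [gaussWeight]

lemma hasLineDerivAt_clm_pow (ℓ : V →L[ℝ] ℂ) (r : ℕ) (x v : V) :
    HasLineDerivAt ℝ (fun y => ℓ y ^ r) (r * ℓ x ^ (r - 1) * ℓ v) x v := by
  unfold HasLineDerivAt
  have h : HasDerivAt (fun t : ℝ => ℓ (x + t • v)) (ℓ v) 0 := by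
    have := ((Complex.ofRealCLM.hasDerivAt (x := (0 : ℝ))).mul_const (ℓ v)).const_add (ℓ x)
    simpa using this
  simpa using! h.pow r

lemma norm_clm_pow_mul_le (ℓ₁ ℓ₂ : V →L[ℝ] ℂ) (r s : ℕ) (x : V) :
    ‖ℓ₁ x ^ r * ℓ₂ x ^ s‖ ≤ ‖ℓ₁‖ ^ r * ‖ℓ₂‖ ^ s * ‖x‖ ^ (r + s) := by
  rw [norm_mul, norm_pow, norm_pow]
  calc ‖ℓ₁ x‖ ^ r * ‖ℓ₂ x‖ ^ s ≤ (‖ℓ₁‖ * ‖x‖) ^ r * (‖ℓ₂‖ * ‖x‖) ^ s := by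
        gcongr <;> exact ContinuousLinearMap.le_opNorm _ _
    _ = _ := by rw [mul_pow, mul_pow, pow_add]; ring

/-- The real-linear functional `x ↦ ⟪A, x⟫ + i ⟪B, x⟫`, i.e. pairing with the complex vector
`A + i B`. -/
def complexPairing (A B : V) : V →L[ℝ] ℂ :=
  Complex.ofRealCLM.comp (innerSL ℝ A) + Complex.I • Complex.ofRealCLM.comp (innerSL ℝ B)

lemma complexPairing_apply (A B x : V) :
    complexPairing A B x = (inner ℝ A x : ℂ) + Complex.I * (inner ℝ B x : ℂ) := by
  simp [complexPairing]

variable [FiniteDimensional ℝ V] [MeasurableSpace V] [BorelSpace V]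

lemma integrable_norm_pow_mul_exp [Nontrivial V] (k : ℕ) :
    Integrable (fun x : V => ‖x‖ ^ k * Real.exp (-‖x‖ ^ 2 / 2)) := by
  rw [integrable_fun_norm_addHaar volume (f := fun y : ℝ => y ^ k * Real.exp (-y ^ 2 / 2))]
  have h := integrableOn_rpow_mul_exp_neg_mul_sq (b := 1 / 2) (by norm_num)
    (s := ((Module.finrank ℝ V - 1 + k : ℕ) : ℝ))
    (lt_of_lt_of_le (by norm_num) (Nat.cast_nonneg _))
  refine h.congr_fun (fun y _ => ?_) measurableSet_Ioi
  simp only [Real.rpow_natCast, smul_eq_mul, pow_add, mul_assoc]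
  congr 3
  ring_nf

lemma integrable_mul_gaussWeight [Nontrivial V] {f : V → ℂ} (hf : Continuous f) {C : ℝ} {k : ℕ}
    (hbound : ∀ x, ‖f x‖ ≤ C * ‖x‖ ^ k) : Integrable (fun x => f x * gaussWeight x) := by
  refine ((integrable_norm_pow_mul_exp (V := V) k).const_mul C).mono'
    (hf.mul continuous_gaussWeight).aestronglyMeasurable (ae_of_all _ fun x => ?_)
  rw [norm_mul, gaussWeight, Complex.norm_real, Real.norm_eq_abs, Real.abs_exp, ← mul_assoc]
  gcongr
  exact hbound x

/-- The Gaussian moment `∫ ℓ₁(x)^r ℓ₂(x)^s exp (-‖x‖² / 2) dx`. -/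
def gaussMoment (ℓ₁ ℓ₂ : V →L[ℝ] ℂ) (r s : ℕ) : ℂ := ∫ x, ℓ₁ x ^ r * ℓ₂ x ^ s * gaussWeight x

lemma integrable_gaussMoment [Nontrivial V] (ℓ₁ ℓ₂ : V →L[ℝ] ℂ) (r s : ℕ) :
    Integrable (fun x => ℓ₁ x ^ r * ℓ₂ x ^ s * gaussWeight x) :=
  integrable_mul_gaussWeight (by fun_prop) (norm_clm_pow_mul_le ℓ₁ ℓ₂ r s)

lemma integrable_inner_mul_gaussMoment [Nontrivial V] (ℓ₁ ℓ₂ : V →L[ℝ] ℂ) (r s : ℕ) (v : V) :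
    Integrable (fun x => (inner ℝ v x : ℂ) * (ℓ₁ x ^ r * ℓ₂ x ^ s) * gaussWeight x) := by
  refine integrable_mul_gaussWeight (C := ‖v‖ * (‖ℓ₁‖ ^ r * ‖ℓ₂‖ ^ s)) (k := r + s + 1)
    (by fun_prop) fun x => ?_
  rw [norm_mul, Complex.norm_real]
  calc ‖(inner ℝ v x : ℝ)‖ * ‖ℓ₁ x ^ r * ℓ₂ x ^ s‖
      ≤ (‖v‖ * ‖x‖) * (‖ℓ₁‖ ^ r * ‖ℓ₂‖ ^ s * ‖x‖ ^ (r + s)) := by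
        gcongr
        · exact norm_inner_le_norm v x
        · exact norm_clm_pow_mul_le ℓ₁ ℓ₂ r s x
    _ = _ := by ring

/-- Gaussian integration by parts in a real direction. -/
lemma integral_inner_mul_gaussWeight [Nontrivial V] (ℓ₁ ℓ₂ : V →L[ℝ] ℂ) (r s : ℕ) (v : V) :
    ∫ x, (inner ℝ v x : ℂ) * (ℓ₁ x ^ r * ℓ₂ x ^ s) * gaussWeight x =
      r * ℓ₁ v * gaussMoment ℓ₁ ℓ₂ (r - 1) s + s * ℓ₂ v * gaussMoment ℓ₁ ℓ₂ r (s - 1) := by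
  have h1 := (integrable_gaussMoment ℓ₁ ℓ₂ (r - 1) s).const_mul (r * ℓ₁ v)
  have h2 := (integrable_gaussMoment ℓ₁ ℓ₂ r (s - 1)).const_mul (s * ℓ₂ v)
  have key := integral_bilinear_hasLineDerivAt_right_eq_neg_left_of_integrable (μ := volume)
    (f := fun x => ℓ₁ x ^ r * ℓ₂ x ^ s)
    (f' := fun x => (r * ℓ₁ x ^ (r - 1) * ℓ₁ v) * ℓ₂ x ^ s +
      ℓ₁ x ^ r * (s * ℓ₂ x ^ (s - 1) * ℓ₂ v))
    (g := gaussWeight) (g' := fun x => -(inner ℝ v x : ℂ) * gaussWeight x) (v := v)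
    (B := ContinuousLinearMap.mul ℝ ℂ) ?_ ?_ ?_ ?_ ?_
  · simp only [ContinuousLinearMap.mul_apply'] at key
    rw [gaussMoment, gaussMoment, ← integral_const_mul, ← integral_const_mul, ← integral_add h1 h2,
      ← neg_inj, ← integral_neg]
    refine Eq.trans ?_ (key.trans (congrArg Neg.neg ?_)) <;>
    · congr 1; ext x; ring
  · refine (h1.add h2).congr (ae_of_all _ fun x => ?_)
    simp only [ContinuousLinearMap.mul_apply', Pi.add_apply]
    ring
  · refine (integrable_inner_mul_gaussMoment ℓ₁ ℓ₂ r s v).neg.congr (ae_of_all _ fun x => ?_)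
    simp only [ContinuousLinearMap.mul_apply', Pi.neg_apply]
    ring
  · exact integrable_gaussMoment ℓ₁ ℓ₂ r s
  · intro x _
    have := (hasLineDerivAt_clm_pow ℓ₁ r x v)
    have h' := (hasLineDerivAt_clm_pow ℓ₂ s x v)
    unfold HasLineDerivAt at *
    simpa using! this.mul h'
  · exact fun x _ => hasLineDerivAt_gaussWeight x v

/-- Gaussian integration by parts in a complex direction. -/
lemma integral_complexPairing_mul_gaussWeight [Nontrivial V] (ℓ₁ ℓ₂ : V →L[ℝ] ℂ) (r s : ℕ)
    (A B : V) :
    ∫ x, complexPairing A B x * (ℓ₁ x ^ r * ℓ₂ x ^ s) * gaussWeight x =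
      r * (ℓ₁ A + Complex.I * ℓ₁ B) * gaussMoment ℓ₁ ℓ₂ (r - 1) s +
        s * (ℓ₂ A + Complex.I * ℓ₂ B) * gaussMoment ℓ₁ ℓ₂ r (s - 1) := by
  have hA := integrable_inner_mul_gaussMoment ℓ₁ ℓ₂ r s A
  have hB := (integrable_inner_mul_gaussMoment ℓ₁ ℓ₂ r s B).const_mul Complex.I
  calc _ = ∫ x, ((inner ℝ A x : ℂ) * (ℓ₁ x ^ r * ℓ₂ x ^ s) * gaussWeight x +
        Complex.I * ((inner ℝ B x : ℂ) * (ℓ₁ x ^ r * ℓ₂ x ^ s) * gaussWeight x)) := by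
        congr 1; ext x; rw [complexPairing_apply]; ring
    _ = _ := by
        rw [integral_add hA hB, integral_const_mul, integral_inner_mul_gaussWeight,
          integral_inner_mul_gaussWeight]
        ring

variable {p A B : V}

lemma gaussMoment_succ_right [Nontrivial V]
    (hnull : complexPairing A B A + Complex.I * complexPairing A B B = 0) (r s : ℕ) :
    gaussMoment (complexPairing p 0) (complexPairing A B) r (s + 1) =
      r * complexPairing A B p *
        gaussMoment (complexPairing p 0) (complexPairing A B) (r - 1) s := by
  have h := integral_complexPairing_mul_gaussWeight (complexPairing p 0) (complexPairing A B)
    r s A B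
  rw [hnull, mul_zero, zero_mul, add_zero] at h
  have hp : complexPairing p 0 A + Complex.I * complexPairing p 0 B = complexPairing A B p := by
    simp [complexPairing_apply, real_inner_comm]
  rw [← hp, ← h, gaussMoment]
  congr 1; ext x; ring

lemma gaussMoment_succ_left [Nontrivial V] (hp : ‖p‖ = 1) (ℓ : V →L[ℝ] ℂ) (r : ℕ) :
    gaussMoment (complexPairing p 0) ℓ (r + 1) 0 =
      r * gaussMoment (complexPairing p 0) ℓ (r - 1) 0 := by
  have h := integral_complexPairing_mul_gaussWeight (complexPairing p 0) ℓ r 0 p 0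
  have hpp : complexPairing p 0 p = 1 := by simp [complexPairing_apply, hp]
  simp only [hpp, map_zero, mul_zero, add_zero, mul_one, Nat.cast_zero, zero_mul] at h
  rw [← h, gaussMoment]
  congr 1; ext x; ring

lemma gaussMoment_eq [Nontrivial V] (hp : ‖p‖ = 1)
    (hnull : complexPairing A B A + Complex.I * complexPairing A B B = 0) (s j : ℕ) :
    gaussMoment (complexPairing p 0) (complexPairing A B) (s + 2 * j) s * (2 ^ j * j.factorial) =
      (s + 2 * j).factorial * complexPairing A B p ^ s * ∫ x : V, gaussWeight x := by
  induction s with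
  | zero =>
    induction j with
    | zero => simp [gaussMoment]
    | succ j ih =>
      simp only [zero_add, pow_zero, mul_one] at ih ⊢
      rw [show 2 * (j + 1) = (2 * j + 1) + 1 by ring, gaussMoment_succ_left hp]
      simp only [Nat.factorial_succ, Nat.add_sub_cancel]
      push_cast
      linear_combination (2 * (j : ℂ) + 1) * (2 * (j + 1)) * ih
  | succ s ih =>
    rw [gaussMoment_succ_right hnull, show s + 1 + 2 * j = (s + 2 * j) + 1 by ring,
      Nat.add_sub_cancel, Nat.factorial_succ]
    push_cast
    linear_combination ((s : ℂ) + 2 * j + 1) * complexPairing A B p * ih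

lemma gaussMoment_eq_zero [Nontrivial V] (hp : ‖p‖ = 1)
    (hnull : complexPairing A B A + Complex.I * complexPairing A B B = 0) (r s : ℕ)
    (hrs : ∀ j, r ≠ s + 2 * j) :
    gaussMoment (complexPairing p 0) (complexPairing A B) r s = 0 := by
  induction s generalizing r with
  | zero =>
    induction r using Nat.twoStepInduction with
    | zero => exact absurd rfl (hrs 0)
    | one => simpa using gaussMoment_succ_left hp (complexPairing A B) 0
    | more r ih _ =>
      rw [gaussMoment_succ_left hp, Nat.add_sub_cancel, ih fun j hj => hrs (j + 1) (by omega),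
        mul_zero]
  | succ s ih =>
    rw [gaussMoment_succ_right hnull]
    rcases r with _ | r
    · simp
    · rw [Nat.add_sub_cancel, ih r fun j hj => hrs j (by omega), mul_zero]

end GaussianMoments

section Polar

/-- A Gaussian integral of a homogeneous function factors into a spherical and a radial integral. -/
lemma integral_homogeneous_mul_gaussWeight {V : Type*} [NormedAddCommGroup V]
    [NormedSpace ℝ V] [FiniteDimensional ℝ V] [Nontrivial V] [MeasurableSpace V]
    [BorelSpace V] (μ : Measure V) [μ.IsAddHaarMeasure] {f : V → ℂ} {k : ℕ}
    (hf : ∀ (c : ℝ) (x : V), f (c • x) = (c : ℂ) ^ k * f x) :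
    ∫ x, f x * gaussWeight x ∂μ = (∫ q : Metric.sphere (0 : V) 1, f q ∂μ.toSphere) *
      ((∫ y in Set.Ioi (0 : ℝ), y ^ (Module.finrank ℝ V - 1 + k) * Real.exp (-y ^ 2 / 2) : ℝ) : ℂ) := by
  have hfactor (x : ({(0 : V)}ᶜ : Set V)) : f x * gaussWeight (x : V) =
      f (homeomorphUnitSphereProd V x).1 *
        (((homeomorphUnitSphereProd V x).2 : ℝ) ^ k *
          Real.exp (-((homeomorphUnitSphereProd V x).2 : ℝ) ^ 2 / 2) : ℝ) := by
    have hx : ‖(x : V)‖ ≠ 0 := norm_ne_zero_iff.2 x.2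
    have h : f x = (‖(x : V)‖ : ℂ) ^ k * f (‖(x : V)‖⁻¹ • (x : V)) := by
      rw [← hf, smul_inv_smul₀ hx]
    rw [h]
    simp only [gaussWeight, homeomorphUnitSphereProd_apply_fst_coe,
      homeomorphUnitSphereProd_apply_snd_coe]
    push_cast
    ring
  calc ∫ x, f x * gaussWeight x ∂μ
      = ∫ x : ({(0 : V)}ᶜ : Set V), f x * gaussWeight (x : V) ∂(μ.comap (↑)) := by
        rw [integral_subtype_comap (measurableSet_singleton _).compl
          fun x => f x * gaussWeight x, restrict_compl_singleton]
    _ = ∫ z, f z.1 * ((z.2 : ℝ) ^ k * Real.exp (-(z.2 : ℝ) ^ 2 / 2) : ℝ)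
          ∂μ.toSphere.prod (.volumeIoiPow (Module.finrank ℝ V - 1)) := by
        simp_rw [hfactor]
        exact μ.measurePreserving_homeomorphUnitSphereProd.integral_comp
          (Homeomorph.measurableEmbedding _)
          fun z => f z.1 * (((z.2 : ℝ) ^ k * Real.exp (-(z.2 : ℝ) ^ 2 / 2) : ℝ) : ℂ)
    _ = (∫ q : Metric.sphere (0 : V) 1, f q ∂μ.toSphere) *
          ∫ y : Set.Ioi (0 : ℝ), (((y : ℝ) ^ k * Real.exp (-(y : ℝ) ^ 2 / 2) : ℝ) : ℂ)
            ∂.volumeIoiPow (Module.finrank ℝ V - 1) :=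
        integral_prod_mul (fun q : Metric.sphere (0 : V) 1 => f q)
          fun y : Set.Ioi (0 : ℝ) => (((y : ℝ) ^ k * Real.exp (-(y : ℝ) ^ 2 / 2) : ℝ) : ℂ)
    _ = _ := by
        rw [integral_complex_ofReal]
        congr 2
        simp only [Measure.volumeIoiPow, ENNReal.ofReal]
        rw [integral_withDensity_eq_integral_smul,
          integral_subtype_comap measurableSet_Ioi fun a : ℝ =>
            Real.toNNReal (a ^ (Module.finrank ℝ V - 1)) • (a ^ k * Real.exp (-a ^ 2 / 2)),
          setIntegral_congr_fun measurableSet_Ioi fun x hx => ?_]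
        · simp only [NNReal.smul_def, Real.coe_toNNReal _ (pow_nonneg (Set.mem_Ioi.1 hx).le _),
            smul_eq_mul, pow_add, mul_assoc]
        · exact (measurable_subtype_coe.pow_const _).real_toNNReal

lemma integral_pow_mul_exp_neg_sq_div_two (N : ℕ) :
    ∫ y in Set.Ioi (0 : ℝ), y ^ (2 + 2 * N) * Real.exp (-y ^ 2 / 2) =
      √(Real.pi / 2) * Nat.doubleFactorial (2 * N + 1) := by
  have h := integral_rpow_mul_exp_neg_mul_rpow (p := 2) (q := ((2 + 2 * N : ℕ) : ℝ)) (b := 1 / 2)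
    (by norm_num) (lt_of_lt_of_le (by norm_num) (Nat.cast_nonneg _)) (by norm_num)
  have e : (((2 + 2 * N : ℕ) : ℝ) + 1) / 2 = (N : ℝ) + 1 + 1 / 2 := by push_cast; ring
  rw [e, neg_div, e, Real.Gamma_nat_add_one_add_half, one_div, Real.inv_rpow zero_le_two,
    ← Real.rpow_neg zero_le_two, neg_neg, Real.rpow_add zero_lt_two, ← Nat.cast_add_one,
    Real.rpow_natCast, inv_eq_one_div, ← Real.sqrt_eq_rpow] at h
  rw [show (∫ y in Set.Ioi (0 : ℝ), y ^ (2 + 2 * N) * Real.exp (-y ^ 2 / 2)) = _ from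
    setIntegral_congr_fun measurableSet_Ioi fun y _ => ?_]
  · refine h.trans ?_
    have h2 : √(2 : ℝ) * √2 = 2 := Real.mul_self_sqrt zero_le_two
    have h3 : √(Real.pi / 2) = √Real.pi * √2 / 2 := by
      rw [Real.sqrt_div Real.pi_pos.le, div_eq_iff (by positivity)]
      linear_combination (-√Real.pi / 2) * h2
    rw [h3]
    field_simp
  · simp only [Real.rpow_natCast, Real.rpow_two]
    congr 2
    ring

end Polar

section SphereIntegrals

lemma integral_gaussWeight_three :
    ∫ x : EuclideanSpace ℝ (Fin 3), gaussWeight x = (4 * Real.pi * √(Real.pi / 2) : ℝ) := by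
  have h := GaussianFourier.integral_rexp_neg_mul_sq_norm (V := EuclideanSpace ℝ (Fin 3))
    (b := 1 / 2) (by norm_num)
  simp only [gaussWeight]
  rw [integral_complex_ofReal]
  congr 1
  rw [show (fun x : EuclideanSpace ℝ (Fin 3) => Real.exp (-‖x‖ ^ 2 / 2)) =
    fun x => Real.exp (-(1 / 2) * ‖x‖ ^ 2) by ext x; congr 1; ring, h]
  rw [finrank_euclideanSpace_fin, show ((3 : ℕ) : ℝ) / 2 = 1 + 1 / 2 by norm_num,
    Real.rpow_add (by positivity), Real.rpow_one, ← Real.sqrt_eq_rpow,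
    show Real.pi / (1 / 2) = 2 ^ 2 * (Real.pi / 2) by ring, Real.sqrt_mul (by positivity),
    Real.sqrt_sq zero_le_two]
  ring

variable {A B : EuclideanSpace ℝ (Fin 3)} (p : S2)

lemma gaussMoment_eq_integral_sphere (r s : ℕ) :
    gaussMoment (complexPairing (p : EuclideanSpace ℝ (Fin 3)) 0) (complexPairing A B) r s =
      (∫ q : S2, (inner ℝ (p : EuclideanSpace ℝ (Fin 3)) (q : EuclideanSpace ℝ (Fin 3)) : ℂ) ^ r *
        complexPairing A B q ^ s ∂sphereMeasure) *
      ((∫ y in Set.Ioi (0 : ℝ), y ^ (2 + (r + s)) * Real.exp (-y ^ 2 / 2) : ℝ) : ℂ) := by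
  have h := integral_homogeneous_mul_gaussWeight
    (volume : Measure (EuclideanSpace ℝ (Fin 3)))
    (f := fun x => complexPairing (p : EuclideanSpace ℝ (Fin 3)) 0 x ^ r * complexPairing A B x ^ s)
    (k := r + s) (fun c x => by simp only [map_smul, Complex.real_smul]; ring)
  simpa [finrank_euclideanSpace_fin, complexPairing_apply, gaussMoment, sphereMeasure] using h

/-- The Funk–Hecke coefficient of the monomial `x ^ (s + 2j)` in degree `s`. -/
def funkHeckeCoeff (s j : ℕ) : ℝ :=
  4 * Real.pi * (s + 2 * j).factorial /
    (2 ^ j * j.factorial * Nat.doubleFactorial (2 * s + 2 * j + 1))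

lemma integral_inner_pow_mul_null_pow
    (hnull : complexPairing A B A + Complex.I * complexPairing A B B = 0) (s j : ℕ) :
    ∫ q : S2, (inner ℝ (p : EuclideanSpace ℝ (Fin 3)) (q : EuclideanSpace ℝ (Fin 3)) : ℂ) ^
        (s + 2 * j) * complexPairing A B q ^ s ∂sphereMeasure =
      funkHeckeCoeff s j * complexPairing A B p ^ s := by
  have h := gaussMoment_eq (p := (p : EuclideanSpace ℝ (Fin 3))) (by simp) hnull s j
  rw [gaussMoment_eq_integral_sphere, integral_gaussWeight_three,
    show 2 + (s + 2 * j + s) = 2 + 2 * (s + j) by ring, integral_pow_mul_exp_neg_sq_div_two,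
    show 2 * (s + j) + 1 = 2 * s + 2 * j + 1 by ring] at h
  have hs : ((√(Real.pi / 2) : ℝ) : ℂ) ≠ 0 := by
    have : √(Real.pi / 2) ≠ 0 := by positivity
    exact_mod_cast this
  have hd : (Nat.doubleFactorial (2 * s + 2 * j + 1) : ℂ) ≠ 0 := by
    exact_mod_cast (Nat.doubleFactorial_pos _).ne'
  have hj : (j.factorial : ℂ) ≠ 0 := by exact_mod_cast j.factorial_ne_zero
  rw [funkHeckeCoeff]
  push_cast at h ⊢
  rw [div_mul_eq_mul_div, eq_div_iff (by simp [hj, hd])]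
  apply mul_right_cancel₀ hs
  linear_combination h

lemma integral_inner_pow_mul_null_pow_eq_zero
    (hnull : complexPairing A B A + Complex.I * complexPairing A B B = 0) (r s : ℕ)
    (hrs : ∀ j, r ≠ s + 2 * j) :
    ∫ q : S2, (inner ℝ (p : EuclideanSpace ℝ (Fin 3)) (q : EuclideanSpace ℝ (Fin 3)) : ℂ) ^ r *
      complexPairing A B q ^ s ∂sphereMeasure = 0 := by
  have h := gaussMoment_eq_zero (p := (p : EuclideanSpace ℝ (Fin 3))) (by simp) hnull r s hrs
  rw [gaussMoment_eq_integral_sphere] at h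
  refine (mul_eq_zero.1 h).resolve_right ?_
  have hpos : 0 < ∫ y in Set.Ioi (0 : ℝ), y ^ (2 + (r + s)) * Real.exp (-y ^ 2 / 2) := by
    have hi := (integrable_fun_norm_addHaar (volume : Measure (EuclideanSpace ℝ (Fin 3)))
      (f := fun y : ℝ => y ^ (r + s) * Real.exp (-y ^ 2 / 2))).1
        (integrable_norm_pow_mul_exp (r + s))
    rw [setIntegral_pos_iff_support_of_nonneg_ae]
    · rw [Set.inter_eq_right.2]
      · simp
      · intro y hy
        have : (0 : ℝ) < y := hy
        exact (show 0 < y ^ (2 + (r + s)) * Real.exp (-y ^ 2 / 2) by positivity).ne'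
    · filter_upwards [ae_restrict_mem measurableSet_Ioi] with y hy
      have : (0 : ℝ) < y := hy
      exact (show 0 < y ^ (2 + (r + s)) * Real.exp (-y ^ 2 / 2) by positivity).le
    · refine hi.congr_fun (fun y _ => ?_) measurableSet_Ioi
      simp [pow_add, mul_assoc]
  exact_mod_cast hpos.ne'

end SphereIntegrals

section GeneratingPolynomial

open Polynomial

/-- The complex number `x + i y` attached to the point `(x, y, z)`. -/
def planarPart (q : S2) : ℂ :=
  ⟨(q : EuclideanSpace ℝ (Fin 3)) 0, (q : EuclideanSpace ℝ (Fin 3)) 1⟩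

/-- The polynomial `u ↦ ⟪ζ(u), q⟫` for the null vectors `ζ(u) = ((u² - 1) / 2, i (u² + 1) / 2, u)`,
whose powers generate the spherical harmonics. -/
def nullPoly (q : S2) : ℂ[X] :=
  C (planarPart q / 2) * X ^ 2 + C (((q : EuclideanSpace ℝ (Fin 3)) 2 : ℝ) : ℂ) * X -
    C (starRingEnd ℂ (planarPart q) / 2)

lemma exists_nullPoly_eval_eq (u : ℂ) : ∃ A B : EuclideanSpace ℝ (Fin 3),
    complexPairing A B A + Complex.I * complexPairing A B B = 0 ∧
      ∀ q : S2, (nullPoly q).eval u = complexPairing A B q := by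
  let ζ : Fin 3 → ℂ := ![(u ^ 2 - 1) / 2, Complex.I * (u ^ 2 + 1) / 2, u]
  have hζ (i : Fin 3) : ((ζ i).re : ℂ) + Complex.I * ((ζ i).im : ℂ) = ζ i := by
    rw [mul_comm]; exact Complex.re_add_im _
  have hpair (x : EuclideanSpace ℝ (Fin 3)) :
      complexPairing (WithLp.toLp 2 fun i => (ζ i).re) (WithLp.toLp 2 fun i => (ζ i).im) x =
        ∑ i, x i * ζ i := by
    rw [complexPairing_apply, PiLp.inner_apply, PiLp.inner_apply, Complex.ofReal_sum,
      Complex.ofReal_sum, Finset.mul_sum, ← Finset.sum_add_distrib]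
    refine Finset.sum_congr rfl fun i _ => ?_
    refine Eq.trans ?_ (congrArg ((x i : ℂ) * ·) (hζ i))
    simp
    ring
  refine ⟨WithLp.toLp 2 fun i => (ζ i).re, WithLp.toLp 2 fun i => (ζ i).im, ?_, fun q => ?_⟩
  · rw [hpair, hpair, Finset.mul_sum, ← Finset.sum_add_distrib]
    have h : ∀ i, ((ζ i).re : ℂ) * ζ i + Complex.I * (((ζ i).im : ℂ) * ζ i) = ζ i ^ 2 := fun i => by
      linear_combination ζ i * hζ i
    simp only [h, Fin.sum_univ_three]
    simp only [ζ, Matrix.cons_val_zero, Matrix.cons_val_one, Matrix.cons_val]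
    linear_combination (u ^ 2 + 1) ^ 2 / 4 * Complex.I_sq
  · rw [hpair, Fin.sum_univ_three]
    have hw : planarPart q = ((q : EuclideanSpace ℝ (Fin 3)) 0 : ℂ) +
        ((q : EuclideanSpace ℝ (Fin 3)) 1 : ℂ) * Complex.I := (Complex.re_add_im _).symm
    simp only [nullPoly, hw, ζ, Matrix.cons_val_zero, Matrix.cons_val_one, Matrix.cons_val]
    simp
    ring

lemma natDegree_nullPoly_pow_lt (q : S2) (s : ℕ) : (nullPoly q ^ s).natDegree < 2 * s + 1 := by
  refine Nat.lt_succ_of_le (natDegree_pow_le.trans ?_)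
  rw [mul_comm]
  refine Nat.mul_le_mul_right s ?_
  unfold nullPoly
  compute_degree

lemma continuous_planarPart : Continuous planarPart := by
  have : planarPart = fun q : S2 => ((q : EuclideanSpace ℝ (Fin 3)) 0 : ℂ) +
      ((q : EuclideanSpace ℝ (Fin 3)) 1 : ℂ) * Complex.I := by
    ext q; exact (Complex.re_add_im _).symm
  rw [this]
  fun_prop

lemma continuous_coeff_nullPoly_pow (s k : ℕ) :
    Continuous fun q : S2 => (nullPoly q ^ s).coeff k := by
  induction s generalizing k with
  | zero => simpa using continuous_const
  | succ s ih =>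
    simp only [pow_succ, coeff_mul]
    refine continuous_finsetSum _ fun i _ => (ih i.1).mul ?_
    have hw := continuous_planarPart
    have hw' := Complex.continuous_conj.comp hw
    simp only [nullPoly, coeff_sub, coeff_add, coeff_C_mul, coeff_C, coeff_X, coeff_X_pow]
    refine ((((hw.div_const 2).mul continuous_const).add (.mul (by fun_prop) continuous_const))).sub
      ?_
    split_ifs
    · exact hw'.div_const 2
    · exact continuous_const

instance : IsFiniteMeasure sphereMeasure := by
  unfold sphereMeasure; infer_instance

lemma integrable_of_continuous {f : S2 → ℂ} (hf : Continuous f) : Integrable f sphereMeasure :=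
  hf.integrable_of_hasCompactSupport (HasCompactSupport.of_compactSpace f)

lemma continuous_inner_pow (p : S2) (r : ℕ) : Continuous fun q : S2 =>
    (inner ℝ (p : EuclideanSpace ℝ (Fin 3)) (q : EuclideanSpace ℝ (Fin 3)) : ℂ) ^ r := by
  fun_prop

/-- An eigenvalue identity for the powers of all null functionals passes to the coefficients
of the generating polynomial. -/
lemma integral_inner_pow_mul_coeff (p : S2) (r s : ℕ) (c : ℂ)
    (h : ∀ A B : EuclideanSpace ℝ (Fin 3),
      complexPairing A B A + Complex.I * complexPairing A B B = 0 →
      ∫ q : S2, (inner ℝ (p : EuclideanSpace ℝ (Fin 3)) (q : EuclideanSpace ℝ (Fin 3)) : ℂ) ^ r *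
        complexPairing A B q ^ s ∂sphereMeasure = c * complexPairing A B p ^ s)
    {k : ℕ} (hk : k < 2 * s + 1) :
    ∫ q : S2, (inner ℝ (p : EuclideanSpace ℝ (Fin 3)) (q : EuclideanSpace ℝ (Fin 3)) : ℂ) ^ r *
      (nullPoly q ^ s).coeff k ∂sphereMeasure = c * (nullPoly p ^ s).coeff k := by
  set J : ℕ → ℂ := fun k => ∫ q : S2,
    (inner ℝ (p : EuclideanSpace ℝ (Fin 3)) (q : EuclideanSpace ℝ (Fin 3)) : ℂ) ^ r *
      (nullPoly q ^ s).coeff k ∂sphereMeasure with hJ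
  have hpoly : ∑ i ∈ Finset.range (2 * s + 1), C (J i) * X ^ i = C c * nullPoly p ^ s := by
    refine Polynomial.funext fun u => ?_
    obtain ⟨A, B, hnull, hAB⟩ := exists_nullPoly_eval_eq u
    rw [eval_mul, eval_C, eval_pow, hAB, ← h A B hnull]
    simp only [eval_finsetSum, eval_mul, eval_C, eval_pow, eval_X, hJ, ← integral_mul_const]
    rw [← integral_finsetSum]
    swap
    · exact fun i _ => integrable_of_continuous
        (((continuous_inner_pow p r).mul (continuous_coeff_nullPoly_pow s i)).mul continuous_const)
    congr 1
    ext q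
    rw [← hAB q, ← eval_pow, eval_eq_sum_range' (natDegree_nullPoly_pow_lt q s), Finset.mul_sum]
    exact Finset.sum_congr rfl fun i _ => by ring
  have hc := congrArg (fun P => P.coeff k) hpoly
  simpa [coeff_C_mul, coeff_X_pow, hk, Nat.lt_succ_iff.1 hk] using hc

lemma normSq_planarPart (q : S2) :
    planarPart q * starRingEnd ℂ (planarPart q) =
      1 - (((q : EuclideanSpace ℝ (Fin 3)) 2 : ℝ) : ℂ) ^ 2 := by
  have h : ‖(q : EuclideanSpace ℝ (Fin 3))‖ ^ 2 = 1 := by simp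
  rw [EuclideanSpace.real_norm_sq_eq, Fin.sum_univ_three] at h
  rw [Complex.mul_conj, Complex.normSq_apply, planarPart]
  have h' : (q : EuclideanSpace ℝ (Fin 3)) 0 * (q : EuclideanSpace ℝ (Fin 3)) 0 +
      (q : EuclideanSpace ℝ (Fin 3)) 1 * (q : EuclideanSpace ℝ (Fin 3)) 1 =
      1 - (q : EuclideanSpace ℝ (Fin 3)) 2 ^ 2 := by linarith
  rw [h']
  push_cast
  ring

lemma iteratedDeriv_eval_polynomial (P : ℝ[X]) (k : ℕ) (x : ℝ) :
    iteratedDeriv k (fun y => P.eval y) x = (derivative^[k] P).eval x := by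
  induction k generalizing P with
  | zero => simp
  | succ k ih =>
    rw [iteratedDeriv_succ', Function.iterate_succ_apply, ← ih]
    congr 1
    ext y
    exact P.deriv

/-- The derivatives of `(y² - 1) ^ s` at `x` are the Taylor coefficients of
`((X + x)² - 1) ^ s`. -/
lemma iteratedDeriv_sq_sub_one_pow (s k : ℕ) (x : ℝ) :
    iteratedDeriv k (fun y : ℝ => (y ^ 2 - 1) ^ s) x =
      k.factorial * ((((X + C x) ^ 2 - 1) ^ s : ℝ[X])).coeff k := by
  have h := iteratedDeriv_eval_polynomial ((X ^ 2 - 1) ^ s) k x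
  simp only [eval_pow, eval_sub, eval_X, eval_one] at h
  rw [h, ← factorial_smul_hasseDeriv, LinearMap.smul_apply, eval_smul, nsmul_eq_mul,
    ← taylor_coeff]
  congr 2
  simp [taylor_apply]

lemma coeff_nullPoly_pow (q : S2) (s k : ℕ) :
    (2 * planarPart q) ^ s * (nullPoly q ^ s).coeff k =
      planarPart q ^ k * ((((X + C ((q : EuclideanSpace ℝ (Fin 3)) 2)) ^ 2 - 1) ^ s : ℝ[X]).coeff k
        : ℝ) := by
  have h : C (2 * planarPart q) ^ s * nullPoly q ^ s =
      (((((X + C ((q : EuclideanSpace ℝ (Fin 3)) 2)) ^ 2 - 1) ^ s : ℝ[X]).map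
        Complex.ofRealHom).comp (C (planarPart q) * X)) := by
    simp only [Polynomial.map_pow, Polynomial.map_sub, Polynomial.map_add, map_X, map_C,
      Polynomial.map_one, pow_comp, sub_comp, add_comp, X_comp, C_comp, one_comp, ← mul_pow]
    congr 1
    have h1 := congrArg (C : ℂ → ℂ[X]) (normSq_planarPart q)
    rw [nullPoly, div_eq_mul_inv, div_eq_mul_inv]
    have h2 : (C (2 : ℂ) * C (2⁻¹ : ℂ) : ℂ[X]) = 1 := by rw [← C_mul]; simp
    simp only [C_mul, C_sub, C_pow, C_1, Complex.ofRealHom_eq_coe] at h1 ⊢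
    have h3 : (C (2 : ℂ) : ℂ[X]) = 2 := rfl
    linear_combination (C (planarPart q) ^ 2 * X ^ 2 -
      C (planarPart q) * C (starRingEnd ℂ (planarPart q))) * h2 - h1 +
      (C (planarPart q) * C (((q : EuclideanSpace ℝ (Fin 3)) 2 : ℝ) : ℂ) * X) * h3
  have hc := congrArg (fun P => P.coeff k) h
  simp only [← C_pow, coeff_C_mul, comp_C_mul_X_coeff, coeff_map] at hc
  rw [hc, mul_comm]
  rfl

lemma coeff_nullPoly_pow_of_planarPart_eq_zero {q : S2} (hq : planarPart q = 0) (s k : ℕ) :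
    (nullPoly q ^ s).coeff k =
      if k = s then (((q : EuclideanSpace ℝ (Fin 3)) 2 : ℝ) : ℂ) ^ s else 0 := by
  rw [nullPoly, hq]
  simp only [zero_div, map_zero, zero_mul, zero_add, sub_zero, mul_pow, ← C_pow, coeff_C_mul,
    coeff_X_pow, mul_ite, mul_one, mul_zero]

lemma planarPart_eq (q : S2) : planarPart q =
    ((√(1 - (q : EuclideanSpace ℝ (Fin 3)) 2 ^ 2) : ℝ) : ℂ) *
      Complex.exp (Complex.I * azimuth q) := by
  have h : ‖planarPart q‖ ^ 2 = 1 - (q : EuclideanSpace ℝ (Fin 3)) 2 ^ 2 := by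
    have := normSq_planarPart q
    rw [Complex.mul_conj'] at this
    exact_mod_cast this
  rw [← h, Real.sqrt_sq (norm_nonneg _), mul_comm Complex.I]
  exact (Complex.norm_mul_exp_arg_mul_I _).symm

/-- Spherical harmonics are, up to a constant factor, the coefficients of the powers of the
generating polynomial. -/
lemma exists_sphHarm_eq_mul_coeff (s : ℕ) (n : ℤ) (hn : |n| ≤ (s : ℤ)) :
    ∃ c : ℂ, ∀ q : S2, sphHarm s n q = c * (nullPoly q ^ s).coeff ((s : ℤ) + n).toNat := by
  obtain ⟨k, hk⟩ : ∃ k : ℕ, (s : ℤ) + n = k := Int.eq_ofNat_of_zero_le (by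
    have := abs_le.1 hn; omega)
  refine ⟨sphNormal s n * (k.factorial / s.factorial), fun q => ?_⟩
  have hs : (s.factorial : ℂ) ≠ 0 := by exact_mod_cast s.factorial_ne_zero
  simp only [sphHarm, assocLegendre, hk, Int.toNat_natCast, iteratedDeriv_sq_sub_one_pow]
  set z := (q : EuclideanSpace ℝ (Fin 3)) 2 with hz
  by_cases hw : planarPart q = 0
  · have hz2 : 1 - z ^ 2 = 0 := by
      have := normSq_planarPart q
      rw [hw, zero_mul] at this
      exact_mod_cast this.symm
    rw [coeff_nullPoly_pow_of_planarPart_eq_zero hw]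
    rcases eq_or_ne n 0 with rfl | hn0
    · have hks : k = s := by omega
      subst hks
      have hT : ((X + C z) ^ 2 - 1 : ℝ[X]) = X * (X + C (2 * z)) := by
        have : (C z ^ 2 : ℝ[X]) = 1 := by rw [← C_pow, show z ^ 2 = 1 by linarith, C_1]
        have h2 : (C (2 : ℝ) : ℝ[X]) = 2 := rfl
        rw [C_mul, h2]
        linear_combination this
      rw [hT, mul_pow, coeff_X_pow_mul', if_pos le_rfl, Nat.sub_self, coeff_zero_eq_eval_zero]
      simp [mul_pow]
      field_simp
      simp [hz]
    · have hks : k ≠ s := by omega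
      rw [hz2, Real.zero_rpow (by simpa using hn0), if_neg hks]
      simp
  · have hexp : Complex.exp (Complex.I * n * azimuth q) =
        Complex.exp (Complex.I * azimuth q) ^ n := by
      rw [← Complex.exp_int_mul]; ring_nf
    have hpos : 0 ≤ 1 - z ^ 2 := by
      have := normSq_planarPart q
      rw [Complex.mul_conj'] at this
      have h : ‖planarPart q‖ ^ 2 = 1 - z ^ 2 := by exact_mod_cast this
      rw [← h]; positivity
    have hrpow : (1 - z ^ 2) ^ ((n : ℝ) / 2) = √(1 - z ^ 2) ^ n := by
      rw [Real.sqrt_eq_rpow, ← Real.rpow_mul_intCast hpos]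
      congr 1; ring
    have hwn : planarPart q ^ n =
        ((√(1 - z ^ 2) : ℝ) : ℂ) ^ n * Complex.exp (Complex.I * azimuth q) ^ n := by
      rw [planarPart_eq, mul_zpow]
    have hc := coeff_nullPoly_pow q s k
    have hkn : planarPart q ^ k = planarPart q ^ s * planarPart q ^ n := by
      rw [← zpow_natCast, ← hk, zpow_add₀ hw, zpow_natCast]
    rw [hkn, mul_pow, ← hz] at hc
    have hc' : 2 ^ s * (nullPoly q ^ s).coeff k = planarPart q ^ n *
        ((((X + C z) ^ 2 - 1) ^ s : ℝ[X]).coeff k : ℝ) :=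
      mul_left_cancel₀ (pow_ne_zero s hw) (by linear_combination hc)
    rw [hwn] at hc'
    rw [hexp, hrpow]
    push_cast
    field_simp
    linear_combination (-(k.factorial : ℂ) * sphNormal s n) * hc'

end GeneratingPolynomial

section Kernel

lemma continuous_sphHarm {s : ℕ} {n : ℤ} (hn : |n| ≤ (s : ℤ)) : Continuous (sphHarm s n) := by
  obtain ⟨c, hc⟩ := exists_sphHarm_eq_mul_coeff s n hn
  rw [funext hc]
  exact continuous_const.mul (continuous_coeff_nullPoly_pow s _)

lemma integral_inner_pow_mul_sphHarm_of_null (p : S2) (r : ℕ) {s : ℕ} {n : ℤ}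
    (hn : |n| ≤ (s : ℤ)) (c : ℂ)
    (h : ∀ A B : EuclideanSpace ℝ (Fin 3),
      complexPairing A B A + Complex.I * complexPairing A B B = 0 →
      ∫ q : S2, (inner ℝ (p : EuclideanSpace ℝ (Fin 3)) (q : EuclideanSpace ℝ (Fin 3)) : ℂ) ^ r *
        complexPairing A B q ^ s ∂sphereMeasure = c * complexPairing A B p ^ s) :
    ∫ q : S2, (inner ℝ (p : EuclideanSpace ℝ (Fin 3)) (q : EuclideanSpace ℝ (Fin 3)) : ℂ) ^ r *
      sphHarm s n q ∂sphereMeasure = c * sphHarm s n p := by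
  obtain ⟨d, hd⟩ := exists_sphHarm_eq_mul_coeff s n hn
  have hk : ((s : ℤ) + n).toNat < 2 * s + 1 := by
    have := abs_le.1 hn; omega
  simp only [hd]
  rw [← mul_assoc, mul_comm c d, mul_assoc, ← integral_inner_pow_mul_coeff p r s c h hk,
    ← integral_const_mul]
  congr 1
  ext q
  ring

lemma integral_inner_pow_mul_sphHarm (p : S2) {s : ℕ} {n : ℤ} (hn : |n| ≤ (s : ℤ)) (j : ℕ) :
    ∫ q : S2, (inner ℝ (p : EuclideanSpace ℝ (Fin 3)) (q : EuclideanSpace ℝ (Fin 3)) : ℂ) ^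
      (s + 2 * j) * sphHarm s n q ∂sphereMeasure = funkHeckeCoeff s j * sphHarm s n p :=
  integral_inner_pow_mul_sphHarm_of_null p _ hn _ fun _ _ hnull =>
    integral_inner_pow_mul_null_pow p hnull s j

lemma integral_inner_pow_mul_sphHarm_eq_zero (p : S2) {s : ℕ} {n : ℤ} (hn : |n| ≤ (s : ℤ))
    {r : ℕ} (hr : ∀ j, r ≠ s + 2 * j) :
    ∫ q : S2, (inner ℝ (p : EuclideanSpace ℝ (Fin 3)) (q : EuclideanSpace ℝ (Fin 3)) : ℂ) ^ r *
      sphHarm s n q ∂sphereMeasure = 0 := by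
  rw [integral_inner_pow_mul_sphHarm_of_null p r hn 0 fun A B hnull => ?_, zero_mul]
  rw [integral_inner_pow_mul_null_pow_eq_zero p hnull r s hr, zero_mul]

lemma abs_inner_le_one (p q : S2) :
    |inner ℝ (p : EuclideanSpace ℝ (Fin 3)) (q : EuclideanSpace ℝ (Fin 3))| ≤ 1 := by
  simpa using abs_real_inner_le_norm (p : EuclideanSpace ℝ (Fin 3)) (q : EuclideanSpace ℝ (Fin 3))

lemma integrable_abs_inner_pow (p : S2) (r : ℕ) : Integrable (fun q : S2 =>
    |inner ℝ (p : EuclideanSpace ℝ (Fin 3)) (q : EuclideanSpace ℝ (Fin 3))| ^ r)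
    sphereMeasure := by
  refine (integrable_const (1 : ℝ)).mono' (by fun_prop) (ae_of_all _ fun q => ?_)
  rw [norm_pow, Real.norm_eq_abs, abs_abs]
  exact pow_le_one₀ (abs_nonneg _) (abs_inner_le_one p q)

lemma integral_abs_inner_pow_even (p : S2) (j : ℕ) :
    ∫ q : S2, |inner ℝ (p : EuclideanSpace ℝ (Fin 3)) (q : EuclideanSpace ℝ (Fin 3))| ^ (2 * j)
      ∂sphereMeasure = funkHeckeCoeff 0 j := by
  have h := integral_inner_pow_mul_null_pow (A := 0) (B := 0) p (by simp) 0 j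
  simp only [zero_add, pow_zero, mul_one, ← Complex.ofReal_pow] at h
  rw [integral_complex_ofReal] at h
  simp only [pow_mul, sq_abs] at h ⊢
  exact_mod_cast h

lemma integral_abs_inner_pow_odd_le (p : S2) (j : ℕ) :
    ∫ q : S2, |inner ℝ (p : EuclideanSpace ℝ (Fin 3)) (q : EuclideanSpace ℝ (Fin 3))| ^ (2 * j + 1)
      ∂sphereMeasure ≤ 3 * funkHeckeCoeff 1 j := by
  calc _ ≤ ∫ q : S2, |inner ℝ (p : EuclideanSpace ℝ (Fin 3))
        (q : EuclideanSpace ℝ (Fin 3))| ^ (2 * j) ∂sphereMeasure :=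
        integral_mono (integrable_abs_inner_pow p _) (integrable_abs_inner_pow p _) fun q =>
          pow_le_pow_of_le_one (abs_nonneg _) (abs_inner_le_one p q) (Nat.le_succ _)
    _ = funkHeckeCoeff 0 j := integral_abs_inner_pow_even p j
    _ ≤ 3 * funkHeckeCoeff 1 j := by
        have h0 : (0 : ℝ) < Nat.doubleFactorial (2 * j + 1) := by
          exact_mod_cast Nat.doubleFactorial_pos _
        have h1 : 3 * funkHeckeCoeff 1 j =
            funkHeckeCoeff 0 j * (3 * (2 * j + 1) / (2 * j + 3)) := by
          simp only [funkHeckeCoeff, show 2 * 1 + 2 * j + 1 = 2 * j + 1 + 2 by ring,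
            show 1 + 2 * j = 2 * j + 1 by ring, Nat.factorial_succ (2 * j),
            Nat.doubleFactorial_add_two, mul_zero, zero_add]
          push_cast
          field_simp
          ring
        have h2 : 0 ≤ funkHeckeCoeff 0 j := by unfold funkHeckeCoeff; positivity
        rw [h1]
        refine le_mul_of_one_le_right h2 ?_
        rw [one_le_div (by positivity)]
        linarith [(Nat.cast_nonneg j : (0 : ℝ) ≤ j)]

/-- The sphere meets the locus `|⟪p, q⟫| = 1` in a null set. -/
lemma ae_abs_inner_lt_one (p : S2) : ∀ᵐ q : S2 ∂sphereMeasure,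
    |inner ℝ (p : EuclideanSpace ℝ (Fin 3)) (q : EuclideanSpace ℝ (Fin 3))| < 1 := by
  have hmeas : MeasurableSet {q : S2 |
      ¬ |inner ℝ (p : EuclideanSpace ℝ (Fin 3)) (q : EuclideanSpace ℝ (Fin 3))| < 1} := by
    have hcont : Continuous fun q : S2 =>
        |inner ℝ (p : EuclideanSpace ℝ (Fin 3)) (q : EuclideanSpace ℝ (Fin 3))| := by fun_prop
    exact (measurableSet_lt hcont.measurable measurable_const).compl
  rw [ae_iff, sphereMeasure, Measure.toSphere_apply' _ hmeas]
  have hspan : (ℝ ∙ (p : EuclideanSpace ℝ (Fin 3))) ≠ ⊤ := fun h => by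
    have h1 := finrank_span_le_card (R := ℝ) {(p : EuclideanSpace ℝ (Fin 3))}
    rw [h, finrank_top, finrank_euclideanSpace_fin] at h1
    simp at h1
  rw [measure_mono_null _ (Measure.addHaar_submodule volume _ hspan), mul_zero]
  rintro _ ⟨c, -, _, ⟨q, hq, rfl⟩, rfl⟩
  refine Submodule.smul_mem _ _ ?_
  have hp : ‖(p : EuclideanSpace ℝ (Fin 3))‖ = 1 := by simp
  have hq' : ‖(q : EuclideanSpace ℝ (Fin 3))‖ = 1 := by simp
  rcases le_abs.1 (not_lt.1 hq) with h | h
  · have : inner ℝ (p : EuclideanSpace ℝ (Fin 3)) (q : EuclideanSpace ℝ (Fin 3)) = 1 :=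
      le_antisymm ((le_abs_self _).trans (abs_inner_le_one p q)) h
    rw [← (inner_eq_one_iff_of_norm_eq_one hp hq').1 this]
    exact Submodule.mem_span_singleton_self _
  · have : inner ℝ (p : EuclideanSpace ℝ (Fin 3)) (-(q : EuclideanSpace ℝ (Fin 3))) = 1 := by
      rw [inner_neg_right]
      exact le_antisymm ((neg_le_abs _).trans (abs_inner_le_one p q)) h
    rw [← neg_neg (q : EuclideanSpace ℝ (Fin 3)),
      ← (inner_eq_one_iff_of_norm_eq_one hp (by rwa [norm_neg])).1 this]
    exact Submodule.neg_mem _ (Submodule.mem_span_singleton_self _)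

lemma summable_abs_mul_integral_abs_inner_pow {a : ℕ → ℝ} (p : S2)
    (hsum : Summable (fun q : ℕ × ℕ =>
      if q.1 ≤ q.2 ∧ (q.2 - q.1) % 2 = 0 then
        |4 * Real.pi * ((4 * q.1 + 1 : ℝ)) ^ ((3 : ℝ) / 2) * a q.2 * (q.2.factorial : ℝ) /
          (2 ^ ((q.2 - q.1) / 2) * (((q.2 - q.1) / 2).factorial : ℝ) *
            (Nat.doubleFactorial (q.1 + q.2 + 1) : ℝ))|
      else 0)) :
    Summable fun r => |a r| * ∫ q : S2, |inner ℝ (p : EuclideanSpace ℝ (Fin 3))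
      (q : EuclideanSpace ℝ (Fin 3))| ^ r ∂sphereMeasure := by
  have hcoeff (s j : ℕ) : 0 ≤ funkHeckeCoeff s j := by unfold funkHeckeCoeff; positivity
  have hdiag (s : ℕ) : Summable fun j => |a (s + 2 * j)| * funkHeckeCoeff s j := by
    have h := hsum.comp_injective (i := fun j : ℕ => (s, s + 2 * j)) fun j j' hjj => by
      simpa using hjj
    refine Summable.of_nonneg_of_le (fun j => mul_nonneg (abs_nonneg _) (hcoeff s j))
      (fun j => ?_) h
    simp only [Function.comp_apply, Nat.le_add_right, Nat.add_sub_cancel_left,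
      Nat.mul_mod_right, and_self, if_true, Nat.mul_div_cancel_left j two_pos]
    rw [show s + (s + 2 * j) + 1 = 2 * s + 2 * j + 1 by ring,
      show 4 * Real.pi * (4 * (s : ℝ) + 1) ^ ((3 : ℝ) / 2) * a (s + 2 * j) *
        ((s + 2 * j).factorial : ℝ) / (2 ^ j * (j.factorial : ℝ) *
          (Nat.doubleFactorial (2 * s + 2 * j + 1) : ℝ)) =
        (4 * (s : ℝ) + 1) ^ ((3 : ℝ) / 2) * (a (s + 2 * j) * funkHeckeCoeff s j) by
          unfold funkHeckeCoeff; ring,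
      abs_mul, abs_mul, abs_of_nonneg (hcoeff s j)]
    refine le_mul_of_one_le_left (mul_nonneg (abs_nonneg _) (hcoeff s j)) ?_
    refine (Real.one_le_rpow ?_ (by norm_num)).trans (le_abs_self _)
    linarith [(Nat.cast_nonneg s : (0 : ℝ) ≤ s)]
  have heven : Summable fun j => |a (2 * j)| * ∫ q : S2, |inner ℝ (p : EuclideanSpace ℝ (Fin 3))
      (q : EuclideanSpace ℝ (Fin 3))| ^ (2 * j) ∂sphereMeasure := by
    simpa only [integral_abs_inner_pow_even, zero_add] using hdiag 0
  have hodd : Summable fun j => |a (2 * j + 1)| * ∫ q : S2,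
      |inner ℝ (p : EuclideanSpace ℝ (Fin 3))
        (q : EuclideanSpace ℝ (Fin 3))| ^ (2 * j + 1) ∂sphereMeasure := by
    refine Summable.of_nonneg_of_le (fun j => by positivity) (fun j => ?_) ((hdiag 1).mul_left 3)
    rw [add_comm 1, mul_left_comm]
    exact mul_le_mul_of_nonneg_left (integral_abs_inner_pow_odd_le p j) (abs_nonneg _)
  exact (heven.hasSum.even_add_odd hodd.hasSum).summable

end Kernel

/-- Suppose the power series `∑ a_r x^r` converges to `k(x)` for `|x| < 1` and the
summability condition
`∑_{l=0}^∞ ∑_{r=l,l+2,…} |4π (4l+1)^(3/2) a_r r! / (2^((r-l)/2) ((r-l)/2)! (l+r+1)!!)| < ∞`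
holds. Then for every `s : ℕ`, every `n : ℤ` with `|n| ≤ s` and every `p ∈ S²`,
`∫_{S²} k(p·q) Y_s^n(q) dq = μ_s Y_s^n(p)` with
`μ_s = ∑_{r=0}^∞ 4π a_{s+2r} (s+2r)! / (2^r r! (2s+2r+1)!!)`:
every spherical harmonic is an eigenfunction of the integral operator with kernel
`k(p·q)`, with eigenvalue `μ_s`. -/
theorem sphHarm_eigenfunction_of_kernel (a : ℕ → ℝ) (k : ℝ → ℝ)
    (hk : ∀ x : ℝ, |x| < 1 → HasSum (fun r : ℕ => a r * x ^ r) (k x))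
    (hsum : Summable (fun q : ℕ × ℕ =>
      if q.1 ≤ q.2 ∧ (q.2 - q.1) % 2 = 0 then
        |4 * Real.pi * ((4 * q.1 + 1 : ℝ)) ^ ((3 : ℝ) / 2) * a q.2 * (q.2.factorial : ℝ) /
          (2 ^ ((q.2 - q.1) / 2) * (((q.2 - q.1) / 2).factorial : ℝ) *
            (Nat.doubleFactorial (q.1 + q.2 + 1) : ℝ))|
      else 0))
    (s : ℕ) (n : ℤ) (hn : |n| ≤ (s : ℤ)) (p : S2) :
    (∫ q : S2, (k (inner (𝕜 := ℝ) (p : EuclideanSpace ℝ (Fin 3))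
        (q : EuclideanSpace ℝ (Fin 3))) : ℂ) * sphHarm s n q ∂sphereMeasure) =
      ((∑' r : ℕ, 4 * Real.pi * a (s + 2 * r) * ((s + 2 * r).factorial : ℝ) /
          (2 ^ r * (r.factorial : ℝ) * (Nat.doubleFactorial (2 * s + 2 * r + 1) : ℝ))) : ℝ) *
        sphHarm s n p := by

  set t : S2 → ℝ := fun q =>
    inner ℝ (p : EuclideanSpace ℝ (Fin 3)) (q : EuclideanSpace ℝ (Fin 3)) with ht
  have hY := continuous_sphHarm hn
  obtain ⟨M, hM⟩ := (isCompact_univ (X := S2)).exists_bound_of_continuousOn hY.continuousOn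
  have hsummable := (summable_abs_mul_integral_abs_inner_pow p hsum).mul_right M
  have hFint (r : ℕ) : Integrable (fun q => (a r : ℂ) * ((t q : ℂ) ^ r * sphHarm s n q))
      sphereMeasure :=
    integrable_of_continuous (continuous_const.mul ((continuous_inner_pow p r).mul hY))
  have hnorm : Summable fun r =>
      ∫ q, ‖(a r : ℂ) * ((t q : ℂ) ^ r * sphHarm s n q)‖ ∂sphereMeasure := by
    refine Summable.of_nonneg_of_le (fun r => integral_nonneg fun q => norm_nonneg _)
      (fun r => ?_) hsummable
    rw [← integral_const_mul, ← integral_mul_const]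
    refine integral_mono (hFint r).norm
      (((integrable_abs_inner_pow p r).const_mul _).mul_const _) fun q => ?_
    simp only [norm_mul, norm_pow, Complex.norm_real, Real.norm_eq_abs, ht, mul_assoc]
    gcongr
    exact hM q (Set.mem_univ q)
  have hmain := hasSum_integral_of_summable_integral_norm hFint hnorm
  have hker : ∫ q, ∑' r, (a r : ℂ) * ((t q : ℂ) ^ r * sphHarm s n q) ∂sphereMeasure =
      ∫ q, (k (t q) : ℂ) * sphHarm s n q ∂sphereMeasure := by
    refine integral_congr_ae ?_
    filter_upwards [ae_abs_inner_lt_one p] with q hq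
    have h := (Complex.hasSum_ofReal.2 (hk (t q) hq)).mul_right (sphHarm s n q)
    rw [← h.tsum_eq]
    congr 1
    ext r
    push_cast
    ring
  simp only [integral_const_mul] at hmain
  rw [hker] at hmain
  have hinj : Function.Injective fun j : ℕ => s + 2 * j := fun i j h => by
    simpa using h
  rw [← hinj.hasSum_iff fun r hr => by
    rw [integral_inner_pow_mul_sphHarm_eq_zero p hn fun j hj => hr ⟨j, hj.symm⟩, mul_zero]] at hmain
  rw [← hmain.tsum_eq, Complex.ofReal_tsum, ← tsum_mul_right]
  congr 1
  ext j
  simp only [Function.comp_apply, ht]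
  rw [integral_inner_pow_mul_sphHarm p hn j, funkHeckeCoeff]
  push_cast
  ring
end
end

section
/- Let K be a continuous symmetric kernel on S²×S² with |K(p,q)| ≤ M for all p,q, and let λ > 0 satisfy 8π M exp(16M/λ) ≤ λ. Then F(·,λ) is strictly convex on the convex set B of probability densities bounded above by exp(16M/λ): for any two such densities ρ₁, ρ₂ ∈ B that differ on a set of positive measure and any t ∈ (0,1), F(tρ₁+(1−t)ρ₂, λ) < t F(ρ₁,λ) + (1−t) F(ρ₂,λ). -/
open MeasureTheory

noncomputable section

/-- A probability density on `S²`: a nonnegative measurable function integrating to `1`. -/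
def IsProbDensity (ρ : S2 → ℝ) : Prop :=
  Measurable ρ ∧ (∀ p, 0 ≤ ρ p) ∧ (∫ p, ρ p ∂sphereMeasure) = 1

/-- The Onsager free energy with interaction kernel `K` and parameter `λ`:
`F(ρ,λ) = λ ∫ ρ ln ρ + (1/2) ∫∫ K(p,q) ρ(p) ρ(q)`. -/
def onsagerF (K : S2 → S2 → ℝ) (lam : ℝ) (ρ : S2 → ℝ) : ℝ :=
  lam * ∫ p, ρ p * Real.log (ρ p) ∂sphereMeasure +
    (1 / 2) * ∫ p, (∫ q, K p q * ρ p * ρ q ∂sphereMeasure) ∂sphereMeasure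

theorem sphereMeasure_real_univ : sphereMeasure.real Set.univ = 4 * Real.pi := by
  have h : (0 : ℝ) ≤ Real.pi * 4 / 3 := by positivity
  rw [sphereMeasure, Measure.toSphere_real_apply_univ, finrank_euclideanSpace, Fintype.card_fin,
    measureReal_def, EuclideanSpace.volume_ball_fin_three, ENNReal.ofReal_one, one_pow, one_mul,
    ENNReal.toReal_ofReal h]
  push_cast
  ring

instance inst_s8 : IsFiniteMeasure sphereMeasure :=
  inferInstanceAs (IsFiniteMeasure (volume : Measure (EuclideanSpace ℝ (Fin 3))).toSphere)

/-- On `[0, B]` the function `x ↦ x log x` has second derivative at least `1 / B`. -/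
theorem convexOn_mul_log_sub_sq {B : ℝ} (hB : 0 < B) :
    ConvexOn ℝ (Set.Icc 0 B) fun x => x * Real.log x - x ^ 2 / (2 * B) := by
  have hderiv : ∀ x ∈ Set.Ioo 0 B,
      HasDerivAt (fun x => x * Real.log x - x ^ 2 / (2 * B)) (Real.log x + 1 - x / B) x := by
    intro x hx
    refine ((Real.hasDerivAt_mul_log hx.1.ne').sub
      (((hasDerivAt_id x).pow 2).div_const (2 * B))).congr_deriv ?_
    simp only [id]
    norm_num
    field_simp
  refine MonotoneOn.convexOn_of_deriv (convex_Icc 0 B)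
    (Real.continuous_mul_log.sub (by fun_prop)).continuousOn ?_ ?_
  · rw [interior_Icc]
    exact fun x hx => (hderiv x hx).differentiableAt.differentiableWithinAt
  · rw [interior_Icc]
    intro x hx y hy hxy
    rw [(hderiv x hx).deriv, (hderiv y hy).deriv]
    have hlog : 1 - x / y ≤ Real.log y - Real.log x := by
      have := Real.one_sub_inv_le_log_of_pos (div_pos hy.1 hx.1)
      rwa [inv_div, Real.log_div hy.1.ne' hx.1.ne'] at this
    have hdiv : (y - x) / B ≤ (y - x) / y :=
      div_le_div_of_nonneg_left (sub_nonneg.2 hxy) hy.1 hy.2.le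
    rw [sub_div, sub_div, div_self hy.1.ne'] at hdiv
    linarith

theorem mul_log_add_sq_le {B x y t : ℝ} (hB : 0 < B) (hx : x ∈ Set.Icc 0 B)
    (hy : y ∈ Set.Icc 0 B) (ht : t ∈ Set.Icc (0 : ℝ) 1) :
    (t * x + (1 - t) * y) * Real.log (t * x + (1 - t) * y)
        + t * (1 - t) / (2 * B) * (x - y) ^ 2 ≤
      t * (x * Real.log x) + (1 - t) * (y * Real.log y) := by
  have h := (convexOn_mul_log_sub_sq hB).2 hx hy ht.1 (sub_nonneg.2 ht.2) (by ring)
  simp only [smul_eq_mul] at h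
  have e : t * (1 - t) / (2 * B) * (x - y) ^ 2 =
      t * (x ^ 2 / (2 * B)) + (1 - t) * (y ^ 2 / (2 * B))
        - (t * x + (1 - t) * y) ^ 2 / (2 * B) := by
    field_simp
    ring
  linarith

section Interaction

variable {X : Type*} [MeasurableSpace X] {μ : Measure X} [IsFiniteMeasure μ]
  {K : X → X → ℝ} {M C : ℝ} {u v : X → ℝ}

theorem integrable_kernel_mul_mul (hK : Measurable fun z : X × X => K z.1 z.2)
    (hKM : ∀ p q, |K p q| ≤ M) (hu : Measurable u) (hC : ∀ p, |u p| ≤ C) :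
    Integrable (fun z : X × X => K z.1 z.2 * u z.1 * u z.2) (μ.prod μ) := by
  refine Integrable.of_bound (C := M * C * C) ?_ (ae_of_all _ fun z => ?_)
  · exact ((hK.mul (hu.comp measurable_fst)).mul (hu.comp measurable_snd)).aestronglyMeasurable
  · rw [Real.norm_eq_abs, abs_mul, abs_mul]
    have hC0 : 0 ≤ C := (abs_nonneg _).trans (hC z.1)
    have hM0 : 0 ≤ M := (abs_nonneg _).trans (hKM z.1 z.2)
    gcongr
    exacts [hKM _ _, hC _, hC _]

theorem integral_kernel_convex_combination (hK : Measurable fun z : X × X => K z.1 z.2)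
    (hKM : ∀ p q, |K p q| ≤ M) (hu : Measurable u) (hv : Measurable v)
    (huC : ∀ p, |u p| ≤ C) (hvC : ∀ p, |v p| ≤ C) (t : ℝ) :
    (∫ p, ∫ q, K p q * (t * u p + (1 - t) * v p) * (t * u q + (1 - t) * v q) ∂μ ∂μ) =
      t * (∫ p, ∫ q, K p q * u p * u q ∂μ ∂μ) + (1 - t) * (∫ p, ∫ q, K p q * v p * v q ∂μ ∂μ)
        - t * (1 - t) * ∫ p, ∫ q, K p q * (u p - v p) * (u q - v q) ∂μ ∂μ := by
  have hIu := integrable_kernel_mul_mul (μ := μ) hK hKM hu huC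
  have hIv := integrable_kernel_mul_mul (μ := μ) hK hKM hv hvC
  have hId := integrable_kernel_mul_mul (μ := μ) (u := fun p => u p - v p) (C := C + C)
    hK hKM (hu.sub hv) fun p => (abs_sub _ _).trans (add_le_add (huC p) (hvC p))
  have key : (fun z : X × X =>
      K z.1 z.2 * (t * u z.1 + (1 - t) * v z.1) * (t * u z.2 + (1 - t) * v z.2)) =
      fun z => t * (K z.1 z.2 * u z.1 * u z.2) + (1 - t) * (K z.1 z.2 * v z.1 * v z.2)
        - t * (1 - t) * (K z.1 z.2 * (u z.1 - v z.1) * (u z.2 - v z.2)) := by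
    funext z
    ring
  have hIuv : Integrable (fun z : X × X => t * (K z.1 z.2 * u z.1 * u z.2)
      + (1 - t) * (K z.1 z.2 * v z.1 * v z.2)) (μ.prod μ) :=
    (hIu.const_mul t).add (hIv.const_mul (1 - t))
  have hIw : Integrable (fun z : X × X =>
      K z.1 z.2 * (t * u z.1 + (1 - t) * v z.1) * (t * u z.2 + (1 - t) * v z.2)) (μ.prod μ) := by
    rw [key]
    exact hIuv.sub (hId.const_mul (t * (1 - t)))
  rw [← integral_prod _ hIw, ← integral_prod _ hIu, ← integral_prod _ hIv,
    ← integral_prod _ hId, key, integral_sub hIuv (hId.const_mul (t * (1 - t))), integral_add (hIu.const_mul t) (hIv.const_mul (1 - t)),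
    integral_const_mul, integral_const_mul, integral_const_mul]

theorem neg_le_integral_kernel_mul_mul (hK : Measurable fun z : X × X => K z.1 z.2)
    (hKM : ∀ p q, |K p q| ≤ M) (hu : Measurable u) (hC : ∀ p, |u p| ≤ C) :
    -(M * μ.real Set.univ * ∫ p, u p ^ 2 ∂μ) ≤ ∫ p, ∫ q, K p q * u p * u q ∂μ ∂μ := by
  have hsq : Integrable (fun p => u p ^ 2) μ := by
    refine Integrable.of_bound (C := C ^ 2) (hu.pow_const 2).aestronglyMeasurable
      (ae_of_all _ fun p => ?_)
    rw [norm_pow, Real.norm_eq_abs]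
    exact pow_le_pow_left₀ (abs_nonneg _) (hC p) 2
  have h₁ : Integrable (fun z : X × X => u z.1 ^ 2) (μ.prod μ) := hsq.comp_fst μ
  have h₂ : Integrable (fun z : X × X => u z.2 ^ 2) (μ.prod μ) := hsq.comp_snd μ
  have hI := integrable_kernel_mul_mul (μ := μ) hK hKM hu hC
  have hlow : ∫ z : X × X, -(M / 2) * (u z.1 ^ 2 + u z.2 ^ 2) ∂μ.prod μ =
      -(M * μ.real Set.univ * ∫ p, u p ^ 2 ∂μ) := by
    rw [integral_const_mul, integral_add h₁ h₂, integral_fun_fst (fun p => u p ^ 2),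
      integral_fun_snd (fun p => u p ^ 2), smul_eq_mul]
    ring
  rw [← hlow, ← integral_prod _ hI]
  refine integral_mono ((h₁.add h₂).const_mul _) hI fun z => ?_
  have hM0 : 0 ≤ M := (abs_nonneg _).trans (hKM z.1 z.2)
  have habs : |K z.1 z.2 * u z.1 * u z.2| ≤ M / 2 * (u z.1 ^ 2 + u z.2 ^ 2) := by
    rw [mul_assoc, abs_mul]
    have hprod : |u z.1 * u z.2| ≤ (u z.1 ^ 2 + u z.2 ^ 2) / 2 := by
      rw [abs_le]
      constructor <;> nlinarith [sq_nonneg (u z.1 - u z.2), sq_nonneg (u z.1 + u z.2)]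
    calc |K z.1 z.2| * |u z.1 * u z.2| ≤ M * ((u z.1 ^ 2 + u z.2 ^ 2) / 2) := by
          gcongr
          exact hKM _ _
      _ = M / 2 * (u z.1 ^ 2 + u z.2 ^ 2) := by ring
  have := (abs_le.1 habs).1
  simp only
  linarith

end Interaction

theorem integral_mul_log_convex_combination_le {X : Type*} [MeasurableSpace X] {μ : Measure X}
    [IsFiniteMeasure μ] {B t : ℝ} {u v : X → ℝ} (hB : 0 < B) (hu : Measurable u)
    (hv : Measurable v) (huB : ∀ p, u p ∈ Set.Icc 0 B) (hvB : ∀ p, v p ∈ Set.Icc 0 B)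
    (ht : t ∈ Set.Icc (0 : ℝ) 1) :
    (∫ p, (t * u p + (1 - t) * v p) * Real.log (t * u p + (1 - t) * v p) ∂μ)
        + t * (1 - t) / (2 * B) * ∫ p, (u p - v p) ^ 2 ∂μ ≤
      t * (∫ p, u p * Real.log (u p) ∂μ) + (1 - t) * ∫ p, v p * Real.log (v p) ∂μ := by
  have hint : ∀ {f : ℝ → ℝ} {a b : ℝ} {w : X → ℝ}, Continuous f → Measurable w →
      (∀ p, w p ∈ Set.Icc a b) → Integrable (fun p => f (w p)) μ := by
    intro f a b w hf hw hwB
    obtain ⟨C, hC⟩ := (isCompact_Icc (a := a) (b := b)).exists_bound_of_continuousOn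
      hf.continuousOn
    exact Integrable.of_bound (hf.measurable.comp hw).aestronglyMeasurable C
      (ae_of_all _ fun p => hC _ (hwB p))
  have hwB : ∀ p, t * u p + (1 - t) * v p ∈ Set.Icc 0 B := fun p =>
    convex_Icc 0 B (huB p) (hvB p) ht.1 (sub_nonneg.2 ht.2) (by ring)
  have hIu := hint Real.continuous_mul_log hu huB
  have hIv := hint Real.continuous_mul_log hv hvB
  have hIw := hint (w := fun p => t * u p + (1 - t) * v p) Real.continuous_mul_log
    ((hu.const_mul t).add (hv.const_mul (1 - t))) hwB
  have hId : Integrable (fun p => (u p - v p) ^ 2) μ :=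
    hint (f := fun x => x ^ 2) (a := -B) (b := B) (by fun_prop) (hu.sub hv) fun p =>
      ⟨by linarith [(huB p).1, (hvB p).2], by linarith [(huB p).2, (hvB p).1]⟩
  rw [← integral_const_mul, ← integral_const_mul, ← integral_const_mul,
    ← integral_add hIw (hId.const_mul _), ← integral_add (hIu.const_mul _) (hIv.const_mul _)]
  exact integral_mono (hIw.add (hId.const_mul _)) ((hIu.const_mul _).add (hIv.const_mul _))
    fun p => mul_log_add_sq_le hB (huB p) (hvB p) ht

theorem integral_sub_sq_pos {X : Type*} [MeasurableSpace X] {μ : Measure X} [IsFiniteMeasure μ]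
    {C : ℝ} {u v : X → ℝ} (hu : Measurable u) (hv : Measurable v) (hC : ∀ p, |u p - v p| ≤ C)
    (hne : 0 < μ {p | u p ≠ v p}) : 0 < ∫ p, (u p - v p) ^ 2 ∂μ := by
  have hI : Integrable (fun p => (u p - v p) ^ 2) μ := by
    refine Integrable.of_bound (C := C ^ 2) ((hu.sub hv).pow_const 2).aestronglyMeasurable
      (ae_of_all _ fun p => ?_)
    rw [norm_pow, Real.norm_eq_abs]
    exact pow_le_pow_left₀ (abs_nonneg _) (hC p) 2
  rw [integral_pos_iff_support_of_nonneg (fun p => sq_nonneg _) hI]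
  convert hne using 2
  ext p
  simp [Function.mem_support, sub_eq_zero]

/-- Strict convexity of the Onsager free energy on the set of probability densities
bounded by `exp(16M/λ)`, provided `8πM exp(16M/λ) ≤ λ`: for densities `ρ₁, ρ₂` in this
set differing on a set of positive measure and `t ∈ (0,1)`,
`F(tρ₁+(1−t)ρ₂) < t F(ρ₁) + (1−t) F(ρ₂)`. -/
theorem onsagerF_strictConvex
    (K : S2 → S2 → ℝ) (hKc : Continuous fun pq : S2 × S2 => K pq.1 pq.2)
    (hKs : ∀ p q, K p q = K q p) (M lam : ℝ)
    (hKM : ∀ p q, |K p q| ≤ M) (hlam : 0 < lam)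
    (hcond : 8 * Real.pi * M * Real.exp (16 * M / lam) ≤ lam)
    (ρ₁ ρ₂ : S2 → ℝ) (hρ₁ : IsProbDensity ρ₁) (hρ₂ : IsProbDensity ρ₂)
    (hb₁ : ∀ p, ρ₁ p ≤ Real.exp (16 * M / lam))
    (hb₂ : ∀ p, ρ₂ p ≤ Real.exp (16 * M / lam))
    (hne : 0 < sphereMeasure {p : S2 | ρ₁ p ≠ ρ₂ p})
    (t : ℝ) (ht : t ∈ Set.Ioo (0 : ℝ) 1) :
    onsagerF K lam (fun p => t * ρ₁ p + (1 - t) * ρ₂ p) <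
      t * onsagerF K lam ρ₁ + (1 - t) * onsagerF K lam ρ₂ := by
  obtain ⟨hm₁, hn₁, -⟩ := hρ₁
  obtain ⟨hm₂, hn₂, -⟩ := hρ₂
  set B := Real.exp (16 * M / lam)
  have hB : 0 < B := Real.exp_pos _
  have hI₁ : ∀ p, ρ₁ p ∈ Set.Icc 0 B := fun p => ⟨hn₁ p, hb₁ p⟩
  have hI₂ : ∀ p, ρ₂ p ∈ Set.Icc 0 B := fun p => ⟨hn₂ p, hb₂ p⟩
  have habs₁ : ∀ p, |ρ₁ p| ≤ B := fun p => by rw [abs_of_nonneg (hn₁ p)]; exact hb₁ p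
  have habs₂ : ∀ p, |ρ₂ p| ≤ B := fun p => by rw [abs_of_nonneg (hn₂ p)]; exact hb₂ p
  have habs : ∀ p, |ρ₁ p - ρ₂ p| ≤ B := fun p =>
    abs_le.2 ⟨by linarith [hn₁ p, hb₂ p], by linarith [hb₁ p, hn₂ p]⟩
  have hent := integral_mul_log_convex_combination_le (μ := sphereMeasure) hB hm₁ hm₂ hI₁ hI₂
    (Set.Ioo_subset_Icc_self ht)
  have hker := integral_kernel_convex_combination (μ := sphereMeasure) hKc.measurable hKM
    hm₁ hm₂ habs₁ habs₂ t
  have hlow := neg_le_integral_kernel_mul_mul (μ := sphereMeasure) hKc.measurable hKM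
    (hm₁.sub hm₂) habs
  have hpos := integral_sub_sq_pos hm₁ hm₂ habs hne
  rw [sphereMeasure_real_univ] at hlow
  simp only [Pi.sub_apply] at hlow
  unfold onsagerF
  rw [hker]
  set D := ∫ p, (ρ₁ p - ρ₂ p) ^ 2 ∂sphereMeasure
  have hs : 0 < t * (1 - t) := mul_pos ht.1 (sub_pos.2 ht.2)
  have hcoef : M * (4 * Real.pi) < lam / B := by
    rw [lt_div_iff₀ hB]
    linarith
  have hgap := mul_lt_mul_of_pos_left (mul_lt_mul_of_pos_right hcoef hpos) hs
  have hlow' := mul_le_mul_of_nonneg_left hlow hs.le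
  have hent' := mul_le_mul_of_nonneg_left hent hlam.le
  have e : lam * (t * (1 - t) / (2 * B) * D) = 1 / 2 * (t * (1 - t) * (lam / B * D)) := by
    field_simp
  rw [mul_add, e] at hent'
  linarith
end
end
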